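/- Let n ≥ 5 with gcd(n,6) = 1, and let λ, κ ∈ Φ3^n. Then the following are equivalent: (1) for every integer ℓ coprime to 3n, the inequality {ℓλ1}_n + {ℓλ2}_n < n holds if and only if {ℓκ1}_n + {ℓκ2}_n < n; (2) κ ∈ ⟨C,J⟩λ. -/

import Mathlib

open scoped Classical
noncomputable section

/-- The set `Φ₃ⁿ` of SU(3) weights at height `n`. -/
def Phi3 (n : ℕ) : Finset (ℤ × ℤ) :=
  (Finset.Icc ((1 : ℤ), (1 : ℤ)) ((n : ℤ), (n : ℤ))).filter (fun l => l.1 + l.2 ≤ (n : ℤ) - 1)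

/-- The order-3 simple current `Jλ = (n−λ₁−λ₂, λ₁)`. -/
def Jv (n : ℕ) (l : ℤ × ℤ) : ℤ × ℤ := ((n : ℤ) - l.1 - l.2, l.1)

/-- Conjugation `Cλ = (λ₂, λ₁)`. -/
def Cv (l : ℤ × ℤ) : ℤ × ℤ := (l.2, l.1)

/-- The orbit `⟨J⟩λ = {λ, Jλ, J²λ}`. -/
def orbJ (n : ℕ) (l : ℤ × ℤ) : Finset (ℤ × ℤ) := {l, Jv n l, Jv n (Jv n l)}

/-- The orbit `⟨C,J⟩λ = {λ, Jλ, J²λ, Cλ, JCλ, J²Cλ}`. -/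
def orbCJ (n : ℕ) (l : ℤ × ℤ) : Finset (ℤ × ℤ) := orbJ n l ∪ orbJ n (Cv l)


open Complex HurwitzZeta Filter Topology MeasureTheory Set Asymptotics in
theorem gp_expZeta_one (a : ℝ) (z : ℂ) (hz : z = cexp (2 * Real.pi * I * a)) (h1 : z ≠ 1)
    (ha : (a : UnitAddCircle) ≠ 0) :
    expZeta a 1 = - Complex.log (1 - z) := by
  have hzn : ‖z‖ = 1 := by
    rw [hz, show (2 * Real.pi * I * a : ℂ) = ((2 * Real.pi * a : ℝ) : ℂ) * I by push_cast; ring]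
    exact norm_exp_ofReal_mul_I _
  set F : ℝ → ℂ := fun t => z * cexp (-t) / (1 - z * cexp (-t)) with hF
  have hnorm : ∀ t : ℝ, ‖z * cexp (-t)‖ = Real.exp (-t) := by
    intro t
    rw [norm_mul, hzn, one_mul, ← ofReal_neg, norm_exp_ofReal]
  have hre : ∀ t : ℝ, 0 ≤ t → 0 < (1 - z * cexp (-t)).re := by
    intro t ht
    have h2 : (z * cexp (-t)).re = z.re * Real.exp (-t) := by
      rw [← ofReal_neg, ← ofReal_exp, re_mul_ofReal]
    have h3 : z.re ≤ 1 := hzn ▸ re_le_norm z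
    have h4 : z.re ≠ 1 := by
      intro h
      apply h1
      have h5 : z.re * z.re + z.im * z.im = 1 := by
        have := Complex.normSq_apply z
        rw [Complex.normSq_eq_norm_sq, hzn] at this
        linarith
      apply Complex.ext
      · simpa using h
      · rw [h] at h5
        have : z.im * z.im = 0 := by linarith
        simpa using this
    have h5 : z.re < 1 := lt_of_le_of_ne h3 h4
    have h6 : Real.exp (-t) ≤ 1 := Real.exp_le_one_iff.mpr (by linarith)
    have h7 := Real.exp_pos (-t)
    rw [sub_re, h2, one_re]
    nlinarith
  have hne : ∀ t : ℝ, 0 ≤ t → 1 - z * cexp (-t) ≠ 0 := by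
    intro t ht h
    have := hre t ht
    rw [h] at this
    simp at this
  have hcont : ContinuousOn F (Ici 0) := by
    apply ContinuousOn.div
    · fun_prop
    · fun_prop
    · intro t ht; exact hne t ht
  have hloc : LocallyIntegrableOn F (Ioi 0) :=
    (hcont.mono Ioi_subset_Ici_self).locallyIntegrableOn measurableSet_Ioi
  have htop : F =O[atTop] fun t => Real.exp (-1 * t) := by
    apply IsBigO.of_bound 2
    filter_upwards [eventually_ge_atTop (1 : ℝ)] with t ht
    have hh : Real.exp (-t) ≤ 1 / 2 := by
      rw [Real.exp_neg, ← one_div]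
      apply one_div_le_one_div_of_le (by norm_num)
      have := Real.add_one_le_exp t
      linarith
    rw [hF]
    simp only [norm_div, hnorm]
    rw [neg_one_mul, Real.norm_of_nonneg (Real.exp_pos _).le]
    have h8 : 1 / 2 ≤ ‖1 - z * cexp (-t)‖ := by
      have := norm_sub_norm_le (1 : ℂ) (z * cexp (-t))
      rw [hnorm, norm_one] at this
      linarith
    rw [div_le_iff₀ (by linarith)]
    nlinarith [Real.exp_pos (-t)]
  have hbot : F =O[𝓝[>] 0] (fun t : ℝ => t ^ (-(0 : ℝ))) := by
    simp only [neg_zero, Real.rpow_zero]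
    have : Tendsto F (𝓝[>] 0) (𝓝 (F 0)) :=
      (hcont 0 self_mem_Ici).tendsto.mono_left (nhdsWithin_mono _ Ioi_subset_Ici_self)
    exact this.isBigO_one ℝ
  have hdiff : DifferentiableAt ℂ (mellin F) 1 :=
    mellin_differentiableAt_of_isBigO_rpow_exp one_pos hloc htop hbot (by simp)
  have hconv : MellinConvergent F 1 :=
    mellinConvergent_of_isBigO_rpow_exp one_pos hloc htop hbot (by simp)
  have hIntg : IntegrableOn F (Ioi 0) := by
    have := hconv
    rw [MellinConvergent] at this
    simpa using this
  have hmel : ∀ s : ℝ, 1 < s → mellin F s = Complex.Gamma s * expZeta a s := by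
    intro s hs
    have hs' : 1 < (s : ℂ).re := by simpa using hs
    have e1 := hasSum_expZeta_of_one_lt_re a hs'
    have e2 := hasSum_mellin (a := fun n : ℕ => if n = 0 then 0 else cexp (2 * Real.pi * I * a * n))
      (p := fun n : ℕ => (n : ℝ)) (F := F) (s := s) ?_ (by linarith) ?_ ?_
    · refine e2.unique ?_
      have e3 := e1.mul_left (Complex.Gamma s)
      refine e3.congr_fun ?_
      intro n
      by_cases hn : n = 0
      · subst hn
        have : (s : ℂ) ≠ 0 := by
          intro h; rw [h] at hs'; simp at hs'; linarith
        simp [this]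
      · simp [hn]; ring
    · intro n
      by_cases hn : n = 0
      · simp [hn]
      · right; positivity
    · intro t ht
      have hlt : ‖z * cexp (-t)‖ < 1 := by
        rw [hnorm]; rw [← Real.exp_zero]; exact Real.exp_lt_exp.mpr (by simpa using ht)
      have g := (hasSum_geometric_of_norm_lt_one hlt).mul_left (z * cexp (-t))
      rw [← div_eq_mul_inv] at g
      rw [← hasSum_nat_add_iff' 1]
      simp only [Finset.range_one, Finset.sum_singleton, if_true, zero_mul, sub_zero]
      refine g.congr_fun ?_
      intro n
      rw [← pow_succ']
      simp only [Nat.add_eq_zero_iff, one_ne_zero, and_false, if_false]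
      rw [mul_pow, hz, ← Complex.exp_nat_mul, ← Complex.exp_nat_mul, ofReal_exp]
      congr 1
      · congr 1; ring
      · congr 1; push_cast; ring
    · have : Summable fun n : ℕ => 1 / (n : ℝ) ^ s := Real.summable_one_div_nat_rpow.mpr hs
      refine Summable.of_nonneg_of_le (fun n => by positivity) (fun n => ?_) this
      simp only [ofReal_re]
      gcongr
      by_cases hn : n = 0
      · simp [hn]
      · simp only [hn, if_false]
        rw [show (2 * Real.pi * I * a * n : ℂ) = ((2 * Real.pi * a * n : ℝ) : ℂ) * I by
          push_cast; ring, norm_exp_ofReal_mul_I]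
  have hval : mellin F 1 = expZeta a 1 := by
    have t1 : Tendsto (fun s : ℝ => mellin F (s : ℂ)) (𝓝[>] 1) (𝓝 (mellin F 1)) := by
      have : Tendsto (fun s : ℝ => (s : ℂ)) (𝓝[>] 1) (𝓝 1) := by
        have : Tendsto (fun s : ℝ => (s : ℂ)) (𝓝 1) (𝓝 ((1 : ℝ) : ℂ)) :=
          Complex.continuous_ofReal.tendsto 1
        rw [ofReal_one] at this
        exact this.mono_left nhdsWithin_le_nhds
      exact hdiff.continuousAt.tendsto.comp this
    have t2 : Tendsto (fun s : ℝ => Complex.Gamma s * expZeta a s) (𝓝[>] 1)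
        (𝓝 (Complex.Gamma 1 * expZeta a 1)) := by
      have : Tendsto (fun s : ℝ => (s : ℂ)) (𝓝[>] 1) (𝓝 1) := by
        have : Tendsto (fun s : ℝ => (s : ℂ)) (𝓝 1) (𝓝 ((1 : ℝ) : ℂ)) :=
          Complex.continuous_ofReal.tendsto 1
        rw [ofReal_one] at this
        exact this.mono_left nhdsWithin_le_nhds
      have g1 : ContinuousAt Complex.Gamma 1 :=
        (Complex.differentiableAt_Gamma 1 (by
          intro m h
          have := congrArg Complex.re h
          simp at this
          have : (0 : ℝ) ≤ m := Nat.cast_nonneg m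
          linarith)).continuousAt
      have g2 : ContinuousAt (expZeta a) 1 :=
        (differentiableAt_expZeta a 1 (Or.inr ha)).continuousAt
      exact (g1.tendsto.comp this).mul (g2.tendsto.comp this)
    have t3 := t1.congr' (f₂ := fun s : ℝ => Complex.Gamma s * expZeta a s) (by
      filter_upwards [self_mem_nhdsWithin] with s hs
      exact hmel s hs)
    have := tendsto_nhds_unique t3 t2
    rw [this, Complex.Gamma_one, one_mul]
  rw [← hval, mellin]
  simp only [sub_self, cpow_zero, one_smul]
  have hd : ∀ t ∈ Ici (0 : ℝ), HasDerivAt (fun t : ℝ => Complex.log (1 - z * cexp (-t))) (F t) t := by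
    intro t ht
    have i1 : HasDerivAt (fun t : ℝ => (1 : ℂ) - z * cexp (-t)) (z * cexp (-t)) t := by
      have : HasDerivAt (fun t : ℝ => (-(t : ℂ))) (-1) t := (HasDerivAt.ofReal_comp (hasDerivAt_id t)).neg
      exact ((this.cexp.const_mul z).const_sub 1).congr_deriv (by ring)
    exact i1.clog_real (Or.inl (hre t ht))
  have hlim : Tendsto (fun t : ℝ => Complex.log (1 - z * cexp (-t))) atTop (𝓝 0) := by
    have j1 : Tendsto (fun t : ℝ => (1 : ℂ) - z * cexp (-t)) atTop (𝓝 1) := by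
      have : Tendsto (fun t : ℝ => z * cexp (-t)) atTop (𝓝 0) := by
        rw [tendsto_zero_iff_norm_tendsto_zero]
        simp_rw [hnorm]
        exact Real.tendsto_exp_neg_atTop_nhds_zero
      simpa using this.const_sub 1
    have := (continuousAt_clog (x := 1) (by simp)).tendsto.comp j1
    simpa [Function.comp_def] using this
  rw [integral_Ioi_of_hasDerivAt_of_tendsto' hd hIntg hlim]
  simp

section GPanalytic
open Complex

theorem gp_one_sub_exp (a : ℝ) : 1 - cexp (2 * Real.pi * I * a) =
    ((2 * Real.sin (Real.pi * a) : ℝ) : ℂ) * cexp (((Real.pi * a - Real.pi / 2 : ℝ) : ℂ) * I) := by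
  have h1 : cexp (2 * Real.pi * I * a) = cexp (Real.pi * a * I) * cexp (Real.pi * a * I) := by
    rw [← Complex.exp_add]; congr 1; ring
  have h2 : cexp (((Real.pi * a - Real.pi / 2 : ℝ) : ℂ) * I) = cexp (Real.pi * a * I) * (-I) := by
    have : cexp (-(Real.pi / 2 * I)) = -I := by
      rw [Complex.exp_neg, Complex.exp_pi_div_two_mul_I, Complex.inv_I]
    rw [← this, ← Complex.exp_add]; congr 1; push_cast; ring
  have h3 : cexp (Real.pi * a * I) * cexp (-(Real.pi * a) * I) = 1 := by
    rw [← Complex.exp_add]; simp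
  have h4 : ((2 * Real.sin (Real.pi * a) : ℝ) : ℂ) =
      (cexp (-(Real.pi * a) * I) - cexp (Real.pi * a * I)) * I := by
    push_cast
    rw [Complex.sin]; ring
  rw [h1, h2, h4]
  linear_combination (-1 : ℂ) * h3 - (cexp (Real.pi * a * I) * cexp (Real.pi * a * I) - cexp (Real.pi * a * I) * cexp (-(Real.pi * a) * I)) * I_sq

theorem gp_log_one_sub (a : ℝ) (h0 : 0 < a) (h1 : a < 1) :
    Complex.log (1 - cexp (2 * Real.pi * I * a)) =
      (Real.log (2 * Real.sin (Real.pi * a)) : ℂ) + ((Real.pi * a - Real.pi / 2 : ℝ) : ℂ) * I := by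
  have hp := Real.pi_pos
  have hs : 0 < 2 * Real.sin (Real.pi * a) := by
    have := Real.sin_pos_of_pos_of_lt_pi (x := Real.pi * a) (by positivity) (by nlinarith)
    linarith
  rw [gp_one_sub_exp, Complex.log_ofReal_mul hs (Complex.exp_ne_zero _), Complex.log_exp]
  · simp; nlinarith
  · simp; nlinarith

theorem gp_log_one_sub_neg (a : ℝ) (h0 : 0 < a) (h1 : a < 1) :
    Complex.log (1 - cexp (2 * Real.pi * I * (-a : ℝ))) =
      (Real.log (2 * Real.sin (Real.pi * a)) : ℂ) - ((Real.pi * a - Real.pi / 2 : ℝ) : ℂ) * I := by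
  have e : cexp (2 * Real.pi * I * (-a : ℝ)) = cexp (2 * Real.pi * I * (1 - a : ℝ)) := by
    have := Complex.exp_periodic (2 * Real.pi * I * (-a : ℝ))
    rw [← this]; congr 1; push_cast; ring
  rw [e, gp_log_one_sub (1 - a) (by linarith) (by linarith)]
  rw [show Real.pi * (1 - a) = Real.pi - Real.pi * a by ring, Real.sin_pi_sub]
  push_cast; ring

theorem gp_exp_ne_one (a : ℝ) (h : ¬ ∃ k : ℤ, a = k) : cexp (2 * Real.pi * I * a) ≠ 1 := by
  intro hh
  rw [Complex.exp_eq_one_iff] at hh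
  obtain ⟨k, hk⟩ := hh
  apply h
  refine ⟨k, ?_⟩
  have : (2 * Real.pi * I : ℂ) ≠ 0 := by simp
  have h2 : (2 * Real.pi * I : ℂ) * a = (2 * Real.pi * I : ℂ) * k := by rw [hk]; ring
  have := mul_left_cancel₀ this h2
  exact_mod_cast this

theorem gp_coe_ne_zero (a : ℝ) (h : ¬ ∃ k : ℤ, a = k) : (a : UnitAddCircle) ≠ 0 := by
  intro hh
  rw [AddCircle.coe_eq_zero_iff] at hh
  obtain ⟨k, hk⟩ := hh
  exact h ⟨k, by simpa using hk.symm⟩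

theorem gp_sinZeta_one (a : ℝ) (h0 : 0 < a) (h1 : a < 1) :
    HurwitzZeta.sinZeta a 1 = Real.pi * (1 / 2 - a) := by
  have n1 : ¬ ∃ k : ℤ, a = k := by
    rintro ⟨k, rfl⟩
    have : (0:ℤ) < k := by exact_mod_cast h0
    have : k < 1 := by exact_mod_cast h1
    omega
  have n2 : ¬ ∃ k : ℤ, -a = k := by
    rintro ⟨k, hk⟩
    exact n1 ⟨-k, by push_cast; linarith⟩
  have e1 := gp_expZeta_one a _ rfl (gp_exp_ne_one a n1) (gp_coe_ne_zero a n1)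
  have e2 := gp_expZeta_one (-a) _ rfl (gp_exp_ne_one (-a) n2) (gp_coe_ne_zero (-a) n2)
  rw [gp_log_one_sub a h0 h1] at e1
  rw [gp_log_one_sub_neg a h0 h1] at e2
  rw [HurwitzZeta.expZeta] at e1 e2
  rw [show ((-a : ℝ) : UnitAddCircle) = -(a : UnitAddCircle) from rfl,
    HurwitzZeta.cosZeta_neg, HurwitzZeta.sinZeta_neg] at e2
  push_cast at e1 e2
  have hI : (I : ℂ) ≠ 0 := I_ne_zero
  have : I * HurwitzZeta.sinZeta a 1 = I * (Real.pi * (1 / 2 - a)) := by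
    linear_combination (e1 - e2) / 2
  exact mul_left_cancel₀ hI this

theorem gp_hurwitzOdd_zero (a : ℝ) (h0 : 0 < a) (h1 : a < 1) :
    HurwitzZeta.hurwitzZetaOdd a 0 = 1 / 2 - a := by
  have := HurwitzZeta.hurwitzZetaOdd_one_sub a (s := 1) (by
    intro n h
    have := congrArg Complex.re h
    simp at this
    have : (0 : ℝ) ≤ n := Nat.cast_nonneg n
    linarith)
  rw [sub_self] at this
  rw [this, gp_sinZeta_one a h0 h1, Complex.Gamma_one, mul_one, mul_one, Complex.sin_pi_div_two, Complex.cpow_neg_one]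
  have : (Real.pi : ℂ) ≠ 0 := by exact_mod_cast Real.pi_ne_zero
  field_simp

theorem gp_sum_ne_zero {m : ℕ} [NeZero m] (χ : DirichletCharacter ℂ m) (hodd : χ.Odd)
    (hp : χ.IsPrimitive) : ∑ j : ZMod m, χ j * (j.val : ℂ) ≠ 0 := by
  have hm1 : m ≠ 1 := by
    rintro rfl
    have : χ (-1) = -1 := hodd
    rw [show (-1 : ZMod 1) = 1 from Subsingleton.elim _ _, map_one] at this
    norm_num at this
  have hχ1 : χ ≠ 1 := by
    rintro rfl
    have : (1 : DirichletCharacter ℂ m) (-1) = -1 := hodd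
    rw [MulChar.one_apply (isUnit_one.neg)] at this
    norm_num at this
  -- L(χ,0) ≠ 0
  have hχi : (χ⁻¹).Odd := by
    have : χ (-1) = -1 := hodd
    have h2 : χ⁻¹ (-1) = -1 := by
      rw [MulChar.inv_apply_eq_inv', this]; norm_num
    exact h2
  have hpi : (χ⁻¹).IsPrimitive := by
    rw [DirichletCharacter.isPrimitive_def] at hp ⊢
    rw [DirichletCharacter.conductor_inv, hp]
  have hL : DirichletCharacter.LFunction χ 0 ≠ 0 := by
    have f := hpi.completedLFunction_one_sub 0
    rw [inv_inv, sub_zero] at f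
    have l1 := DirichletCharacter.LFunction_eq_completed_div_gammaFactor χ⁻¹ 1 (Or.inl one_ne_zero)
    have l0 := DirichletCharacter.LFunction_eq_completed_div_gammaFactor χ 0 (Or.inr hm1)
    have nz := DirichletCharacter.LFunction_apply_one_ne_zero (χ := χ⁻¹) (by simpa using hχ1)
    intro h
    rw [h, hodd.gammaFactor_def] at l0
    have hG : Complex.Gammaℝ (0 + 1) ≠ 0 := Complex.Gammaℝ_ne_zero_of_re_pos (by simp)
    have c0 : DirichletCharacter.completedLFunction χ 0 = 0 := by
      rcases div_eq_zero_iff.mp l0.symm with h | h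
      · exact h
      · exact absurd h hG
    rw [c0, mul_zero] at f
    rw [f, zero_div] at l1
    exact nz l1
  have hof : Function.Odd (χ : ZMod m → ℂ) := DirichletCharacter.Odd.to_fun hodd
  have hform : DirichletCharacter.LFunction χ 0 = ∑ j : ZMod m, χ j * (1 / 2 - (j.val : ℂ) / m) := by
    unfold DirichletCharacter.LFunction
    rw [ZMod.LFunction_def_odd hof, neg_zero, Complex.cpow_zero, one_mul]
    refine Finset.sum_congr rfl fun j _ => ?_
    by_cases hj : j = 0
    · subst hj
      have : χ 0 = 0 := by
        apply χ.map_nonunit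
        intro h
        have := isUnit_zero_iff.mp h
        have : Subsingleton (ZMod m) := subsingleton_of_zero_eq_one this
        have := ZMod.subsingleton_iff.mp this
        exact hm1 this
      rw [this, zero_mul, zero_mul]
    · congr 1
      rw [ZMod.toAddCircle_apply, gp_hurwitzOdd_zero]
      · push_cast; rfl
      · have : 0 < j.val := Nat.pos_of_ne_zero (by simpa using hj)
        have : 0 < m := NeZero.pos m
        positivity
      · rw [div_lt_one (by exact_mod_cast NeZero.pos m)]
        exact_mod_cast ZMod.val_lt j
  have hz : ∑ j : ZMod m, χ j = 0 := by
    have := MulChar.sum_eq_zero_of_ne_one hχ1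
    exact this
  intro h0
  apply hL
  rw [hform]
  calc ∑ j : ZMod m, χ j * (1 / 2 - (j.val : ℂ) / m)
      = (∑ j : ZMod m, χ j) * (1/2) - (∑ j : ZMod m, χ j * (j.val : ℂ)) / m := by
        rw [Finset.sum_mul, Finset.sum_div, ← Finset.sum_sub_distrib]
        refine Finset.sum_congr rfl fun j _ => ?_
        ring
    _ = 0 := by rw [hz, h0]; simp

end GPanalytic

section GPabstract
set_option linter.unusedSectionVars false
set_option linter.unusedSimpArgs false

variable {G : Type} [CommGroup G] [Fintype G]

/-- The l1 norm of an integer valued function. -/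
def gpN (c : G → ℤ) : ℤ := ∑ u, |c u|

/-- Annihilation by all products of `(h - 1)`, `h` in the listed subgroups. -/
def gpKilled (H : ℕ → Subgroup G) : List ℕ → (G → ℤ) → Prop
  | [], c => ∀ u, c u = 0
  | q :: L, c => ∀ h ∈ H q, gpKilled H L (fun u => c (h * u) - c u)

/-- Restriction of `c` to the coset `K x`. -/
def gpSl (K : Subgroup G) (x : G) (c : G → ℤ) : G → ℤ :=
  fun u => if u * x⁻¹ ∈ K then c u else 0

theorem gpN_nonneg (c : G → ℤ) : 0 ≤ gpN c := Finset.sum_nonneg fun _ _ => abs_nonneg _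

theorem gpN_eq_zero {c : G → ℤ} (h : gpN c = 0) (u : G) : c u = 0 := by
  have := (Finset.sum_eq_zero_iff_of_nonneg (fun u _ => abs_nonneg (c u))).mp h u (Finset.mem_univ u)
  simpa using this

theorem gpN_le_of_mem (c : G → ℤ) (X : Finset G) : ∑ u ∈ X, |c u| ≤ gpN c :=
  Finset.sum_le_sum_of_subset_of_nonneg (Finset.subset_univ X) fun _ _ _ => abs_nonneg _

theorem gpN_pos {c : G → ℤ} {u : G} (h : c u ≠ 0) : 1 ≤ gpN c := by
  have := gpN_le_of_mem c {u}
  rw [Finset.sum_singleton] at this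
  have : 0 < |c u| := abs_pos.mpr h
  omega

theorem gpN_sub_le (c d : G → ℤ) : gpN (fun u => c u - d u) ≤ gpN c + gpN d := by
  unfold gpN
  rw [← Finset.sum_add_distrib]
  exact Finset.sum_le_sum fun u _ => abs_sub _ _

theorem gpN_translate (c : G → ℤ) (g : G) : gpN (fun u => c (g * u)) = gpN c :=
  Fintype.sum_equiv (Equiv.mulLeft g) _ _ fun _ => rfl

theorem gpKilled_congr (H : ℕ → Subgroup G) (L : List ℕ) {c d : G → ℤ} (h : gpKilled H L c)
    (hcd : ∀ u, c u = d u) : gpKilled H L d := by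
  have : c = d := funext hcd
  rwa [← this]

theorem gpKilled_neg (H : ℕ → Subgroup G) (L : List ℕ) : ∀ {c : G → ℤ}, gpKilled H L c →
    gpKilled H L (fun u => - c u) := by
  induction L with
  | nil => intro c h u; simp [h u]
  | cons q L ih =>
    intro c h g hg
    exact gpKilled_congr H L (ih (h g hg)) fun u => by ring

theorem gpSl_killed (H : ℕ → Subgroup G) (K : Subgroup G) (x : G) (L : List ℕ)
    (hL : ∀ j ∈ L, H j ≤ K) : ∀ {c : G → ℤ}, gpKilled H L c → gpKilled H L (gpSl K x c) := by
  induction L with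
  | nil => intro c h u; simp [gpSl, h u]
  | cons q L ih =>
    intro c h g hg
    refine gpKilled_congr H L (ih (fun j hj => hL j (List.mem_cons_of_mem _ hj)) (h g hg)) fun u => ?_
    have hgK : g ∈ K := hL q List.mem_cons_self hg
    have : g * u * x⁻¹ ∈ K ↔ u * x⁻¹ ∈ K := by
      rw [mul_assoc]; exact Subgroup.mul_mem_cancel_left K hgK
    simp only [gpSl, this]
    split_ifs <;> simp

/-- difference restricted to the slice -/
theorem gpSl_diff (K : Subgroup G) (x h : G) (c : G → ℤ) (u : G) :
    gpSl K x (fun u => c (h * u) - c u) u = gpSl K (h * x) c (h * u) - gpSl K x c u := by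
  have : h * u * (h * x)⁻¹ = u * x⁻¹ := by
    rw [← div_eq_mul_inv, ← div_eq_mul_inv]; exact mul_div_mul_left_eq_div u x h
  simp only [gpSl, this]
  split_ifs <;> simp

theorem gpSl_diff_norm (K : Subgroup G) (x h : G) (c : G → ℤ) :
    gpN (gpSl K x (fun u => c (h * u) - c u)) ≤ gpN (gpSl K (h * x) c) + gpN (gpSl K x c) := by
  have e : gpSl K x (fun u => c (h * u) - c u) =
      fun u => (fun u => gpSl K (h * x) c (h * u)) u - gpSl K x c u := funext (gpSl_diff K x h c)
  rw [e]
  refine (gpN_sub_le _ _).trans ?_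
  rw [gpN_translate (gpSl K (h * x) c) h]

theorem gpSl_empty (H : ℕ → Subgroup G) (K : Subgroup G) (i : ℕ) (L : List ℕ)
    (hL : ∀ j ∈ L, H j ≤ K) {c : G → ℤ} (hc : gpKilled H (i :: L) c) (x h : G) (hh : h ∈ H i)
    (he : ∀ u, gpSl K (h * x) c u = 0) : gpKilled H L (gpSl K x c) := by
  have := gpKilled_neg H L (gpSl_killed H K x L hL (hc h hh))
  refine gpKilled_congr H L this fun u => ?_
  rw [gpSl_diff, he]; ring

theorem gpSl_le (K : Subgroup G) (x : G) (c : G → ℤ) (u : G) : |gpSl K x c u| ≤ |c u| := by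
  unfold gpSl; split_ifs <;> simp

theorem gpN_slice_sum (K : Subgroup G) (c : G → ℤ) (X : Finset G)
    (hX : ∀ x ∈ X, ∀ y ∈ X, x * y⁻¹ ∈ K → x = y) : ∑ x ∈ X, gpN (gpSl K x c) ≤ gpN c := by
  unfold gpN
  rw [Finset.sum_comm]
  refine Finset.sum_le_sum fun u _ => ?_
  by_cases h : ∃ x ∈ X, u * x⁻¹ ∈ K
  · obtain ⟨x, hx, hu⟩ := h
    rw [Finset.sum_eq_single_of_mem x hx]
    · exact gpSl_le K x c u
    · intro y hy hyx
      have : ¬ u * y⁻¹ ∈ K := by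
        intro hy2
        apply hyx
        apply hX y hy x hx
        have := K.mul_mem (K.inv_mem hy2) hu
        rwa [mul_inv_rev, inv_inv, mul_assoc, inv_mul_cancel_left] at this
      simp [gpSl, this]
  · rw [Finset.sum_eq_zero]
    · exact abs_nonneg _
    · intro x hx
      have : ¬ u * x⁻¹ ∈ K := fun hu => h ⟨x, hx, hu⟩
      simp [gpSl, this]

/-- `c` is `±1` on one coset of a four element subgroup and zero elsewhere. -/
def gpLine (H : ℕ → Subgroup G) (L : List ℕ) (c : G → ℤ) : Prop :=
  ∃ i ∈ L, Nat.card (H i) = 4 ∧ ∃ (a : G) (ε : ℤ), (ε = 1 ∨ ε = -1) ∧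
    ∀ u, c u = if u * a⁻¹ ∈ H i then ε else 0

/-- coset as a finset -/
def gpCos (H : Subgroup G) (a : G) : Finset G := Finset.univ.filter fun u => u * a⁻¹ ∈ H

theorem gpCos_card (H : Subgroup G) (a : G) : (gpCos H a).card = Nat.card H := by
  have : Nat.card H = (Finset.univ.filter fun u => u ∈ H).card := by
    rw [Nat.card_eq_fintype_card, Fintype.card_subtype]
  rw [this]
  refine Finset.card_bij (fun u _ => u * a⁻¹) ?_ ?_ ?_
  · intro u hu; simpa [gpCos] using hu
  · intro u _ v _ h; exact mul_right_cancel h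
  · intro b hb; exact ⟨b * a, by simpa [gpCos] using hb, by simp⟩

theorem gpCos_mem (H : Subgroup G) (a u : G) : u ∈ gpCos H a ↔ u * a⁻¹ ∈ H := by simp [gpCos]

theorem gpLine_norm (H : ℕ → Subgroup G) (L : List ℕ) (c : G → ℤ) (h : gpLine H L c) : gpN c = 4 := by
  obtain ⟨i, _, h4, a, ε, hε, hc⟩ := h
  unfold gpN
  have h1 : |ε| = 1 := by rcases hε with h | h <;> simp [h]
  have : ∀ u, |c u| = if u ∈ gpCos (H i) a then 1 else 0 := by
    intro u; simp only [hc u, gpCos_mem]; split_ifs <;> simp [h1]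
  simp only [this]
  rw [Finset.sum_ite_mem, Finset.univ_inter, Finset.sum_const, gpCos_card, h4]; rfl

/-- the `H x` orbit is a set of representatives of different `K` cosets -/
theorem gpCos_sep (H K : Subgroup G) (hHK : H ⊓ K = ⊥) (x : G) :
    ∀ y ∈ gpCos H x, ∀ z ∈ gpCos H x, y * z⁻¹ ∈ K → y = z := by
  intro y hy z hz h
  rw [gpCos_mem] at hy hz
  have h1 : y * z⁻¹ ∈ H := by
    have := H.mul_mem hy (H.inv_mem hz)
    rwa [mul_inv_rev, inv_inv, mul_assoc, inv_mul_cancel_left] at this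
  have : y * z⁻¹ ∈ H ⊓ K := ⟨h1, h⟩
  rw [hHK, Subgroup.mem_bot] at this
  exact mul_inv_eq_one.mp this

theorem gpW (H K : ℕ → Subgroup G) (L : List ℕ) : L.Nodup →
    (∀ i ∈ L, H i ⊓ K i = ⊥) → (∀ i ∈ L, ∀ j ∈ L, i ≠ j → H j ≤ K i) →
    (∀ i ∈ L, 4 ≤ Nat.card (H i)) → ∀ c : G → ℤ, gpKilled H L c → gpN c ≤ 4 →
    (∀ u, c u = 0) ∨ gpLine H L c := by
  induction L with
  | nil => intro _ _ _ _ c hc _; exact Or.inl hc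
  | cons i L ih =>
    intro hnd hb hle h4 c hc hN
    have hnd' := List.nodup_cons.mp hnd
    have IH := ih hnd'.2 (fun j hj => hb j (List.mem_cons_of_mem _ hj))
      (fun j hj k hk => hle j (List.mem_cons_of_mem _ hj) k (List.mem_cons_of_mem _ hk))
      (fun j hj => h4 j (List.mem_cons_of_mem _ hj))
    have hLK : ∀ j ∈ L, H j ≤ K i := fun j hj =>
      hle i List.mem_cons_self j (List.mem_cons_of_mem _ hj) (fun e => hnd'.1 (e ▸ hj))
    by_cases hcase : ∃ x, ∀ y ∈ gpCos (H i) x, ∃ u, gpSl (K i) y c u ≠ 0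
    · obtain ⟨x, hx⟩ := hcase
      right
      have hsum := gpN_slice_sum (K i) c (gpCos (H i) x) (gpCos_sep _ _ (hb i List.mem_cons_self) x)
      have hge : ∀ y ∈ gpCos (H i) x, 1 ≤ gpN (gpSl (K i) y c) := by
        intro y hy; obtain ⟨u, hu⟩ := hx y hy; exact gpN_pos hu
      have hcard := gpCos_card (H i) x
      have h4i := h4 i List.mem_cons_self
      have hcs : ((gpCos (H i) x).card : ℤ) ≤ ∑ y ∈ gpCos (H i) x, gpN (gpSl (K i) y c) := by
        have := Finset.card_nsmul_le_sum _ _ _ hge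
        simpa using this
      have hc4 : Nat.card (H i) = 4 := by
        have : ((gpCos (H i) x).card : ℤ) ≤ 4 := by linarith
        have : (gpCos (H i) x).card ≤ 4 := by exact_mod_cast this
        omega
      have hle1 : ∀ y ∈ gpCos (H i) x, gpN (gpSl (K i) y c) ≤ 1 := by
        intro y hy
        have e := Finset.add_sum_erase _ (fun y => gpN (gpSl (K i) y c)) hy
        have := Finset.card_nsmul_le_sum ((gpCos (H i) x).erase y)
          (fun y => gpN (gpSl (K i) y c)) 1 (fun z hz => hge z (Finset.mem_of_mem_erase hz))
        rw [Finset.card_erase_of_mem hy, hcard, hc4] at this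
        simp at this e
        linarith
      have hxx : x ∈ gpCos (H i) x := by simp [gpCos_mem, Subgroup.one_mem]
      obtain ⟨a, ha⟩ := hx x hxx
      have haK : a * x⁻¹ ∈ K i := by
        by_contra h; exact ha (by simp [gpSl, h])
      have hca : c a ≠ 0 := by simpa [gpSl, haK] using ha
      have hinv : ∀ h ∈ H i, c (h * a) = c a := by
        intro h hh
        have hk := gpSl_killed H (K i) x L hLK (hc h hh)
        have hn := gpSl_diff_norm (K i) x h c
        have m1 := hle1 (h * x) (by rw [gpCos_mem]; simpa using hh)
        have m2 := hle1 x hxx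
        rcases IH _ hk (by linarith) with hz | hl
        · have := hz a
          simp only [gpSl, haK, if_true] at this
          omega
        · have := gpLine_norm _ _ _ hl
          omega
      have habs : |c a| ≤ 1 := by
        have := gpN_le_of_mem (gpSl (K i) x c) {a}
        rw [Finset.sum_singleton] at this
        have h2 := hle1 x hxx
        simp only [gpSl, haK, if_true] at this
        linarith
      have hε : c a = 1 ∨ c a = -1 := by
        have : 0 < |c a| := abs_pos.mpr hca
        have : |c a| = 1 := by omega
        exact (abs_eq (by norm_num)).mp this
      refine ⟨i, List.mem_cons_self, hc4, a, c a, hε, ?_⟩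
      intro u
      split_ifs with hu
      · have := hinv _ hu; simpa using this
      · by_contra hne
        have := gpN_le_of_mem c (insert u (gpCos (H i) a))
        rw [Finset.sum_insert (by rw [gpCos_mem]; exact hu)] at this
        have e : ∑ v ∈ gpCos (H i) a, |c v| = 4 := by
          rw [Finset.sum_congr rfl (g := fun _ => (1 : ℤ))]
          · rw [Finset.sum_const, gpCos_card, hc4]; rfl
          · intro v hv
            rw [gpCos_mem] at hv
            have := hinv _ hv
            rw [inv_mul_cancel_right] at this
            rw [this]
            rcases hε with h | h <;> simp [h]
        have : 0 < |c u| := abs_pos.mpr hne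
        omega
    · push Not at hcase
      by_cases hz : ∀ u, c u = 0
      · exact Or.inl hz
      right
      push Not at hz
      obtain ⟨a, ha⟩ := hz
      obtain ⟨y, hy, hye⟩ := hcase a
      rw [gpCos_mem] at hy
      have hk := gpSl_empty H (K i) i L hLK hc a _ hy (by simpa using hye)
      have hle : gpN (gpSl (K i) a c) ≤ gpN c := Finset.sum_le_sum fun u _ => gpSl_le _ _ _ _
      have haa : gpSl (K i) a c a = c a := by simp [gpSl, Subgroup.one_mem]
      rcases IH _ hk (by linarith) with h0 | hl
      · have := h0 a; rw [haa] at this; exact absurd this ha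
      · have hn4 := gpLine_norm _ _ _ hl
        have heq : ∀ u, gpSl (K i) a c u = c u := by
          have hsum : ∑ u, (|c u| - |gpSl (K i) a c u|) = 0 := by
            rw [Finset.sum_sub_distrib]
            unfold gpN at *
            linarith
          intro u
          have := (Finset.sum_eq_zero_iff_of_nonneg (fun u _ => by
            have := gpSl_le (K i) a c u; linarith)).mp hsum u (Finset.mem_univ u)
          unfold gpSl at this ⊢
          split_ifs at this ⊢
          · rfl
          · simp at this; exact this.symm
        obtain ⟨j, hj, hj4, b, ε, hε, hf⟩ := hl
        exact ⟨j, List.mem_cons_of_mem _ hj, hj4, b, ε, hε, fun u => by rw [← heq, hf u]⟩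

end GPabstract

section GPabstract2
set_option linter.unusedSectionVars false
set_option linter.unusedSimpArgs false

variable {G : Type} [CommGroup G] [Fintype G]

/-- The structural hypotheses on the subgroups. -/
def gpSys (H K : ℕ → Subgroup G) (L : List ℕ) : Prop :=
  L.Nodup ∧ (∀ i ∈ L, H i ⊓ K i = ⊥) ∧ (∀ i ∈ L, ∀ j ∈ L, i ≠ j → H j ≤ K i) ∧
    (∀ i ∈ L, 4 ≤ Nat.card (H i))

theorem gpSys_tail {H K : ℕ → Subgroup G} {i : ℕ} {L : List ℕ} (h : gpSys H K (i :: L)) :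
    gpSys H K L := by
  obtain ⟨h1, h2, h3, h4⟩ := h
  exact ⟨(List.nodup_cons.mp h1).2, fun j hj => h2 j (List.mem_cons_of_mem _ hj),
      (fun j hj k hk => h3 j (List.mem_cons_of_mem _ hj) k (List.mem_cons_of_mem _ hk)),
      (fun j hj => h4 j (List.mem_cons_of_mem _ hj))⟩

theorem gpSys_le {H K : ℕ → Subgroup G} {i : ℕ} {L : List ℕ} (h : gpSys H K (i :: L)) :
    ∀ j ∈ L, H j ≤ K i := by
  obtain ⟨h1, h2, h3, h4⟩ := h
  exact fun j hj => h3 i List.mem_cons_self j (List.mem_cons_of_mem _ hj)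
    (fun e => (List.nodup_cons.mp h1).1 (e ▸ hj))

theorem gpW' {H K : ℕ → Subgroup G} {L : List ℕ} (h : gpSys H K L) {c : G → ℤ}
    (hc : gpKilled H L c) (hN : gpN c ≤ 3) : ∀ u, c u = 0 := by
  rcases gpW H K L h.1 h.2.1 h.2.2.1 h.2.2.2 c hc (by linarith) with h0 | h0
  · exact h0
  · have := gpLine_norm _ _ _ h0; omega

theorem gpSl_self (K : Subgroup G) (a : G) (c : G → ℤ) : gpSl K a c a = c a := by
  simp [gpSl, Subgroup.one_mem]

theorem gpSl_e (K : Subgroup G) (y e : G) (c : G → ℤ) (hanti : ∀ u, c (e * u) = - c u) (u : G) :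
    gpSl K (e * y) c (e * u) = - gpSl K y c u := by
  have : e * u * (e * y)⁻¹ = u * y⁻¹ := by
    rw [← div_eq_mul_inv, ← div_eq_mul_inv]; exact mul_div_mul_left_eq_div u y e
  simp only [gpSl, this, hanti]
  split_ifs <;> simp

theorem gpSl_e_norm (K : Subgroup G) (y e : G) (c : G → ℤ) (hanti : ∀ u, c (e * u) = - c u) :
    gpN (gpSl K (e * y) c) = gpN (gpSl K y c) := by
  rw [← gpN_translate (gpSl K (e * y) c) e]
  unfold gpN
  refine Finset.sum_congr rfl fun u _ => ?_
  simp only [gpSl_e K y e c hanti, abs_neg]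

theorem gpSl_congr (K : Subgroup G) (x y : G) (c : G → ℤ) (h : x * y⁻¹ ∈ K) :
    gpSl K x c = gpSl K y c := by
  funext u
  have : u * x⁻¹ ∈ K ↔ u * y⁻¹ ∈ K := by
    have e : u * y⁻¹ = u * x⁻¹ * (x * y⁻¹) := by
      rw [mul_assoc, inv_mul_cancel_left]
    rw [e]; exact (Subgroup.mul_mem_cancel_right K h).symm
  simp only [gpSl, this]

theorem gpA {H K : ℕ → Subgroup G} {p : ℕ} {L : List ℕ} (hS : gpSys H K (p :: L))
    {e : G} (he : e * e = 1) (heK : e ∉ K p) {c : G → ℤ} (hanti : ∀ u, c (e * u) = - c u)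
    (hc : gpKilled H (p :: L) c) (hN : gpN c ≤ 12)
    (hcase : ∀ x, ∃ y ∈ gpCos (H p) x, ∀ u, gpSl (K p) y c u = 0) {a : G} (ha : c a ≠ 0) :
    (∀ u, c u ≠ 0 → u * a⁻¹ ∈ K p ∨ u * (e * a)⁻¹ ∈ K p) ∧
      (gpN c ≤ 8 → gpLine H L (gpSl (K p) a c)) := by
  have hk : ∀ x, gpKilled H L (gpSl (K p) x c) := by
    intro x
    obtain ⟨y, hy, hye⟩ := hcase x
    rw [gpCos_mem] at hy
    exact gpSl_empty H (K p) p L (gpSys_le hS) hc x _ hy (by simpa using hye)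
  have h4 : ∀ x, c x ≠ 0 → 4 ≤ gpN (gpSl (K p) x c) := by
    intro x hx
    by_contra hlt
    have := gpW' (gpSys_tail hS) (hk x) (by omega) x
    rw [gpSl_self] at this
    exact hx this
  have hne : ∀ x, c x ≠ 0 → c (e * x) ≠ 0 := by
    intro x hx; rw [hanti]; simpa using hx
  have hei : e⁻¹ = e := inv_eq_of_mul_eq_one_left he
  have sw1 : ∀ x y : G, x * (e * y)⁻¹ = e * (x * y⁻¹) := by
    intro x y; rw [mul_inv, hei]; exact mul_left_comm _ _ _
  have sw2 : ∀ x y : G, (e * x) * y⁻¹ = e * (x * y⁻¹) := fun x y => mul_assoc _ _ _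
  have hee : ∀ x : G, e * (e * x) = x := fun x => by rw [← mul_assoc, he, one_mul]
  constructor
  · intro u hu
    by_contra hcon
    push Not at hcon
    obtain ⟨c1, c2⟩ := hcon
    rw [sw1] at c2
    have c1' : a * u⁻¹ ∉ K p := fun h => c1 (by
      have := (K p).inv_mem h; rwa [mul_inv_rev, inv_inv] at this)
    have c2' : e * (a * u⁻¹) ∉ K p := fun h => c2 (by
      have := (K p).inv_mem h; rwa [mul_inv, hei, mul_inv_rev, inv_inv] at this)
    have key := gpN_slice_sum (K p) c {a, e * a, u, e * u} (by
      simp only [Finset.mem_insert, Finset.mem_singleton]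
      intro x hx y hy hh
      rcases hx with hx | hx | hx | hx <;> rcases hy with hy | hy | hy | hy <;>
        rw [hx, hy] at hh <;> rw [hx, hy] <;> exfalso <;>
        (try simp only [sw1, sw2, hee, mul_inv_cancel, mul_one] at hh) <;>
        first | exact heK hh | exact c1 hh | exact c2 hh | exact c1' hh | exact c2' hh)
    have n1 : a ≠ e * a := by
      intro h; apply heK
      have : e = 1 := by
        have := congrArg (· * a⁻¹) h; simpa using this.symm
      rw [this]; exact (K p).one_mem
    have n2 : a ≠ u := by intro h; exact c1 (by simp [h, Subgroup.one_mem])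
    have n3 : a ≠ e * u := by
      intro h
      apply c2'; rw [h, sw2, mul_inv_cancel, mul_one, he]; exact (K p).one_mem
    have n4 : e * a ≠ u := by
      intro h; apply n3; rw [← h, hee]
    have n5 : e * a ≠ e * u := fun h => n2 (mul_left_cancel h)
    have n6 : u ≠ e * u := by
      intro h; apply heK
      have : e = 1 := by
        have := congrArg (· * u⁻¹) h; simpa using this.symm
      rw [this]; exact (K p).one_mem
    rw [Finset.sum_insert (by simp [n1, n2, n3]), Finset.sum_insert (by
      simp only [Finset.mem_insert, Finset.mem_singleton, not_or]; exact ⟨n4, n5⟩),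
      Finset.sum_insert (by simpa using n6), Finset.sum_singleton] at key
    have := h4 a ha
    have := h4 u hu
    have := h4 _ (hne a ha)
    have := h4 _ (hne u hu)
    omega
  · intro h8
    have n1 : a ≠ e * a := by
      intro h; apply heK
      have : e = 1 := by
        have := congrArg (· * a⁻¹) h; simpa using this.symm
      rw [this]; exact (K p).one_mem
    have key := gpN_slice_sum (K p) c {a, e * a} (by
      simp only [Finset.mem_insert, Finset.mem_singleton]
      intro x hx y hy hh
      rcases hx with hx | hx <;> rcases hy with hy | hy <;>
        rw [hx, hy] at hh <;> rw [hx, hy] <;> exfalso <;>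
        (try simp only [sw1, sw2, hee, mul_inv_cancel, mul_one] at hh) <;>
        exact heK hh)
    rw [Finset.sum_insert (by simpa using n1), Finset.sum_singleton] at key
    have := h4 _ (hne a ha)
    have hT := gpSys_tail hS
    rcases gpW H K L hT.1 hT.2.1 hT.2.2.1 hT.2.2.2 _ (hk a) (by omega) with h0 | h0
    · have := h0 a; rw [gpSl_self] at this; exact absurd this ha
    · exact h0

theorem gpN_parity (f : G → ℤ) : (2 : ℤ) ∣ gpN f - ∑ u, f u := by
  unfold gpN
  rw [← Finset.sum_sub_distrib]
  refine Finset.dvd_sum fun u _ => ?_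
  rcases abs_choice (f u) with h | h <;> rw [h] <;> omega

theorem gp_sum_bound {Y : Finset G} {f : G → ℤ} {k : ℤ} (h1 : ∀ y ∈ Y, k ≤ f y)
    (hs : ∑ y ∈ Y, f y ≤ k * Y.card) : ∀ y ∈ Y, f y ≤ k := by
  intro y hy
  by_contra hlt
  push Not at hlt
  have : ∑ y ∈ Y, k < ∑ y ∈ Y, f y := Finset.sum_lt_sum h1 ⟨y, hy, hlt⟩
  rw [Finset.sum_const, nsmul_eq_mul, mul_comm] at this
  omega

theorem gpB {H K : ℕ → Subgroup G} {p : ℕ} {L : List ℕ} (hS : gpSys H K (p :: L))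
    {e : G} (he : e * e = 1) {c : G → ℤ} (hanti : ∀ u, c (e * u) = - c u)
    (hc : gpKilled H (p :: L) c) {x : G}
    (hx : ∀ y ∈ gpCos (H p) x, ∃ u, gpSl (K p) y c u ≠ 0) :
    2 * (Nat.card (H p) : ℤ) ≤ gpN c ∧ (gpN c ≤ 2 * (Nat.card (H p) : ℤ) →
      (∀ i ∈ L, 5 ≤ Nat.card (H i)) → ∃ a, c a ≠ 0 ∧ ∀ h ∈ H p, c (h * a) = c a) := by
  have hei : e⁻¹ = e := inv_eq_of_mul_eq_one_left he
  have hge : ∀ y ∈ gpCos (H p) x, 1 ≤ gpN (gpSl (K p) y c) := by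
    intro y hy; obtain ⟨u, hu⟩ := hx y hy; exact gpN_pos hu
  have hcard := gpCos_card (H p) x
  have hxx : x ∈ gpCos (H p) x := by simp [gpCos_mem, Subgroup.one_mem]
  have main : 2 * (Nat.card (H p) : ℤ) ≤ gpN c ∧ (gpN c ≤ 2 * (Nat.card (H p) : ℤ) →
      ∀ y ∈ gpCos (H p) x, gpN (gpSl (K p) y c) ≤ 2) := by
    have hsep := gpCos_sep (H p) (K p) (hS.2.1 p List.mem_cons_self)
    by_cases heHK : ∃ h0 ∈ H p, ∃ k0 ∈ K p, e = h0 * k0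
    · obtain ⟨h0, hh0, k0, hk0, hek⟩ := heHK
      have h2 : ∀ y ∈ gpCos (H p) x, 2 ≤ gpN (gpSl (K p) y c) := by
        intro y hy
        by_contra hlt
        have h1 : gpN (gpSl (K p) y c) = 1 := by have := hge y hy; omega
        have s1 : gpSl (K p) (h0 * y) c = gpSl (K p) (e * y) c := by
          apply gpSl_congr
          rw [← div_eq_mul_inv, mul_div_mul_right_eq_div, hek, div_eq_mul_inv, mul_inv,
            mul_inv_cancel_left]
          exact (K p).inv_mem hk0
        have hn := gpSl_diff_norm (K p) y h0 c
        rw [s1, gpSl_e_norm (K p) y e c hanti, h1] at hn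
        have hz := gpW' (gpSys_tail hS) (gpSl_killed H (K p) y L (gpSys_le hS) (hc h0 hh0))
          (by linarith)
        have hz2 : ∀ u, gpSl (K p) y c (k0⁻¹ * u) = - gpSl (K p) y c u := by
          intro u
          have := hz u
          rw [gpSl_diff, s1] at this
          have e1 : h0 * u = e * (k0⁻¹ * u) := by rw [hek]; simp [mul_assoc]
          rw [e1, gpSl_e (K p) y e c hanti] at this
          omega
        have hsum : ∑ u, gpSl (K p) y c u = - ∑ u, gpSl (K p) y c u := by
          conv_lhs => rw [← Fintype.sum_equiv (Equiv.mulLeft k0⁻¹)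
            (fun u => gpSl (K p) y c (k0⁻¹ * u)) _ (fun u => rfl)]
          simp only [hz2, Finset.sum_neg_distrib]
        have hp := gpN_parity (gpSl (K p) y c)
        rw [h1] at hp
        omega
      have hsum := gpN_slice_sum (K p) c (gpCos (H p) x) (hsep x)
      have hcs := Finset.card_nsmul_le_sum _ _ _ h2
      rw [hcard] at hcs
      simp only [nsmul_eq_mul] at hcs
      refine ⟨by linarith, fun hle => gp_sum_bound h2 ?_⟩
      rw [hcard]; linarith
    · have hge' : ∀ y ∈ gpCos (H p) (e * x), 1 ≤ gpN (gpSl (K p) y c) := by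
        intro y hy
        have := gpSl_e_norm (K p) (e * y) e c hanti
        rw [← mul_assoc, he, one_mul] at this
        rw [this]
        apply hge
        rw [gpCos_mem] at hy ⊢
        convert hy using 1
        rw [mul_inv, hei, mul_left_comm, mul_assoc]
      have hdis : ∀ y ∈ gpCos (H p) x, ∀ z ∈ gpCos (H p) (e * x), y * z⁻¹ ∉ K p := by
        intro y hy z hz h
        rw [gpCos_mem] at hy hz
        apply heHK
        refine ⟨z * (e * x)⁻¹ * (y * x⁻¹)⁻¹, (H p).mul_mem hz ((H p).inv_mem hy), y * z⁻¹, h, ?_⟩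
        simp only [mul_inv, hei, inv_inv]
        have : z * (e * x⁻¹) * (y⁻¹ * x) * (y * z⁻¹) = e * (z * z⁻¹) * (x * x⁻¹) * (y * y⁻¹) := by
          ac_rfl
        rw [this]; simp
      have hsum := gpN_slice_sum (K p) c (gpCos (H p) x ∪ gpCos (H p) (e * x)) (by
        intro y hy z hz h
        have h' : z * y⁻¹ ∈ K p := by
          have := (K p).inv_mem h; rwa [mul_inv_rev, inv_inv] at this
        rw [Finset.mem_union] at hy hz
        rcases hy with hy | hy <;> rcases hz with hz | hz
        · exact hsep x y hy z hz h
        · exact absurd h (hdis y hy z hz)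
        · exact absurd h' (hdis z hz y hy)
        · exact hsep (e * x) y hy z hz h)
      rw [Finset.sum_union (by
        rw [Finset.disjoint_left]
        intro y hy hy2
        exact hdis y hy y hy2 (by simp [Subgroup.one_mem]))] at hsum
      have hcs := Finset.card_nsmul_le_sum _ _ _ hge
      have hcs' := Finset.card_nsmul_le_sum _ _ _ hge'
      rw [gpCos_card] at hcs hcs'
      simp only [nsmul_eq_mul, mul_one] at hcs hcs'
      refine ⟨by linarith, fun hle y hy => ?_⟩
      have := gp_sum_bound hge (by rw [hcard]; linarith) y hy
      omega
  refine ⟨main.1, fun hle h5 => ?_⟩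
  have hle2 := main.2 hle
  obtain ⟨a, ha⟩ := hx x hxx
  have haK : a * x⁻¹ ∈ K p := by
    by_contra h; exact ha (by simp [gpSl, h])
  have hca : c a ≠ 0 := by simpa [gpSl, haK] using ha
  refine ⟨a, hca, fun h hh => ?_⟩
  have hk := gpSl_killed H (K p) x L (gpSys_le hS) (hc h hh)
  have hn := gpSl_diff_norm (K p) x h c
  have m1 := hle2 (h * x) (by rw [gpCos_mem]; simpa using hh)
  have m2 := hle2 x hxx
  have hT := gpSys_tail hS
  rcases gpW H K L hT.1 hT.2.1 hT.2.2.1 hT.2.2.2 _ hk (by linarith) with hz | hl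
  · have := hz a
    simp only [gpSl, haK, if_true] at this
    omega
  · obtain ⟨i, hi, hi4, _⟩ := hl
    have := h5 i hi
    omega

/-- Support of a function with `H`-invariant values on one coset, if the norm is small. -/
theorem gpInv (H : Subgroup G) {e : G} (he : e * e = 1) (heH : e ∉ H) {c : G → ℤ}
    (hanti : ∀ u, c (e * u) = - c u) {a : G} (ha : c a ≠ 0)
    (hinv : ∀ h ∈ H, c (h * a) = c a) : 2 * (Nat.card H : ℤ) ≤ gpN c ∧
    (∀ b, b * a⁻¹ ∉ H → b * (e * a)⁻¹ ∉ H → 2 * (Nat.card H : ℤ) + |c b| ≤ gpN c) ∧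
    (∀ b, b * a⁻¹ ∉ H → b * (e * a)⁻¹ ∉ H → c b ≠ 0 → (∀ h ∈ H, c (h * b) = c b) →
      4 * (Nat.card H : ℤ) ≤ gpN c) := by
  have hei : e⁻¹ = e := inv_eq_of_mul_eq_one_left he
  have sw1 : ∀ x y : G, x * (e * y)⁻¹ = e * (x * y⁻¹) := by
    intro x y; rw [mul_inv, hei]; exact mul_left_comm _ _ _
  have hee : ∀ x : G, e * (e * x) = x := fun x => by rw [← mul_assoc, he, one_mul]
  have hcos : ∀ b, c b ≠ 0 → (∀ h ∈ H, c (h * b) = c b) →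
      (Nat.card H : ℤ) ≤ ∑ u ∈ gpCos H b, |c u| := by
    intro b hb hi
    have := Finset.card_nsmul_le_sum (gpCos H b) (fun u => |c u|) 1 (by
      intro u hu
      rw [gpCos_mem] at hu
      have := hi _ hu
      rw [inv_mul_cancel_right] at this
      rw [this]
      have : 0 < |c b| := abs_pos.mpr hb
      omega)
    rw [gpCos_card] at this
    simpa using this
  have hine : ∀ b, (∀ h ∈ H, c (h * b) = c b) → (∀ h ∈ H, c (h * (e * b)) = c (e * b)) := by
    intro b hi h hh
    rw [mul_left_comm, hanti, hanti, hi h hh]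
  have hne : ∀ x, c x ≠ 0 → c (e * x) ≠ 0 := by
    intro x hx; rw [hanti]; simpa using hx
  have hd : ∀ x y, y * x⁻¹ ∉ H → Disjoint (gpCos H x) (gpCos H y) := by
    intro x y h
    rw [Finset.disjoint_left]
    intro u hu hv
    rw [gpCos_mem] at hu hv
    apply h
    have := H.mul_mem (H.inv_mem hv) hu
    rwa [mul_inv_rev, inv_inv, mul_assoc, inv_mul_cancel_left] at this
  have d1 : Disjoint (gpCos H a) (gpCos H (e * a)) := hd _ _ (by simpa using heH)
  have hA := hcos a ha hinv
  have hB := hcos _ (hne a ha) (hine a hinv)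
  refine ⟨?_, ?_, ?_⟩
  · have := gpN_le_of_mem c (gpCos H a ∪ gpCos H (e * a))
    rw [Finset.sum_union d1] at this
    linarith
  · intro b h1 h2
    have := gpN_le_of_mem c (insert b (gpCos H a ∪ gpCos H (e * a)))
    rw [Finset.sum_insert (by
      rw [Finset.mem_union, gpCos_mem, gpCos_mem]; tauto), Finset.sum_union d1] at this
    linarith
  · intro b h1 h2 hb hi
    have hC := hcos b hb hi
    have hD := hcos _ (hne b hb) (hine b hi)
    have d2 : Disjoint (gpCos H b) (gpCos H (e * b)) := hd _ _ (by simpa using heH)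
    rw [sw1] at h2
    have d3 : Disjoint (gpCos H a ∪ gpCos H (e * a)) (gpCos H b ∪ gpCos H (e * b)) := by
      rw [Finset.disjoint_union_left, Finset.disjoint_union_right, Finset.disjoint_union_right]
      refine ⟨⟨hd _ _ h1, hd _ _ ?_⟩, hd _ _ ?_, hd _ _ ?_⟩
      · rwa [mul_assoc]
      · rwa [sw1]
      · rw [sw1, mul_assoc, hee]; exact h1
    have := gpN_le_of_mem c ((gpCos H a ∪ gpCos H (e * a)) ∪ (gpCos H b ∪ gpCos H (e * b)))
    rw [Finset.sum_union d3, Finset.sum_union d1, Finset.sum_union d2] at this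
    linarith

end GPabstract2

section GPchar

theorem gp_orth_killed {m : ℕ} [NeZero m] (H : ℕ → Subgroup (ZMod m)ˣ) (L : List ℕ) :
    ∀ c : (ZMod m)ˣ → ℤ, (∀ χ : DirichletCharacter ℂ m, (∀ q ∈ L, ∃ h ∈ H q, χ (h : ZMod m) ≠ 1) →
      ∑ u : (ZMod m)ˣ, (c u : ℂ) * χ (u : ZMod m) = 0) → gpKilled H L c := by
  induction L with
  | nil =>
    intro c hc u
    have h1 : ∀ χ : DirichletCharacter ℂ m, ∑ v : (ZMod m)ˣ, (c v : ℂ) * χ (v : ZMod m) = 0 :=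
      fun χ => hc χ (by simp)
    have h2 : ∑ v : (ZMod m)ˣ, (c v : ℂ) *
        ∑ χ : DirichletCharacter ℂ m, χ ((u : ZMod m)⁻¹) * χ (v : ZMod m) = 0 := by
      simp only [Finset.mul_sum]
      rw [Finset.sum_comm]
      refine Finset.sum_eq_zero fun χ _ => ?_
      have := h1 χ
      calc ∑ v : (ZMod m)ˣ, (c v : ℂ) * (χ ((u : ZMod m)⁻¹) * χ (v : ZMod m))
          = χ ((u : ZMod m)⁻¹) * ∑ v : (ZMod m)ˣ, (c v : ℂ) * χ (v : ZMod m) := by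
            rw [Finset.mul_sum]; refine Finset.sum_congr rfl fun v _ => ?_; ring
        _ = 0 := by rw [this, mul_zero]
    simp only [DirichletCharacter.sum_char_inv_mul_char_eq ℂ u.isUnit] at h2
    rw [Finset.sum_eq_single u] at h2
    · rw [if_pos rfl] at h2
      have : (m.totient : ℂ) ≠ 0 := by
        have := Nat.totient_pos.mpr (NeZero.pos m)
        exact_mod_cast this.ne'
      rcases mul_eq_zero.mp h2 with h | h
      · exact_mod_cast h
      · exact absurd h this
    · intro v _ hv
      rw [if_neg (fun h => hv (Units.ext h.symm)), mul_zero]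
    · simp
  | cons q L ih =>
    intro c hc g hg
    apply ih
    intro χ hχ
    have e : ∑ u : (ZMod m)ˣ, ((c (g * u) - c u : ℤ) : ℂ) * χ (u : ZMod m) =
        (χ ((g⁻¹ : (ZMod m)ˣ) : ZMod m) - 1) * ∑ u : (ZMod m)ˣ, (c u : ℂ) * χ (u : ZMod m) := by
      have s : ∑ u : (ZMod m)ˣ, (c (g * u) : ℂ) * χ (u : ZMod m) =
          ∑ u : (ZMod m)ˣ, (c u : ℂ) * χ ((g⁻¹ * u : (ZMod m)ˣ) : ZMod m) :=
        Fintype.sum_equiv (Equiv.mulLeft g) _ _ fun u => by simp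
      push_cast
      simp only [sub_mul, Finset.sum_sub_distrib, one_mul]
      rw [s, Finset.mul_sum]
      congr 1
      refine Finset.sum_congr rfl fun u _ => ?_
      rw [Units.val_mul, map_mul]; ring
    rw [e]
    by_cases h1 : χ ((g⁻¹ : (ZMod m)ˣ) : ZMod m) = 1
    · rw [h1]; simp
    · rw [hc χ, mul_zero]
      intro q' hq'
      rcases List.mem_cons.mp hq' with rfl | h
      · exact ⟨g⁻¹, (H q').inv_mem hg, h1⟩
      · exact hχ q' h

end GPchar

section GPlevel

/-- The embedding of `ZMod m` into `ZMod n` by multiplication with `n / m`. -/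
def gpI (n m : ℕ) (x : ZMod m) : ZMod n := ((n / m * x.val : ℕ) : ZMod n)

theorem gpI_natCast {n m : ℕ} [NeZero n] [NeZero m] (h : m ∣ n) (k : ℕ) :
    gpI n m (k : ZMod m) = ((n / m * k : ℕ) : ZMod n) := by
  unfold gpI
  rw [ZMod.val_natCast, ZMod.natCast_eq_natCast_iff]
  have := (Nat.mod_modEq k m).mul_left' (n / m)
  rwa [Nat.div_mul_cancel h] at this

theorem gpI_val {n m : ℕ} [NeZero n] [NeZero m] (h : m ∣ n) (x : ZMod m) :
    (gpI n m x).val = n / m * x.val := by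
  unfold gpI
  rw [ZMod.val_natCast, Nat.mod_eq_of_lt]
  have h1 := ZMod.val_lt x
  have h2 : 0 < n / m := Nat.div_pos (Nat.le_of_dvd (NeZero.pos n) h) (NeZero.pos m)
  calc n / m * x.val < n / m * m := Nat.mul_lt_mul_of_pos_left h1 h2
    _ = n := Nat.div_mul_cancel h

theorem gpI_mul {n m : ℕ} [NeZero n] [NeZero m] (h : m ∣ n) (l : ZMod n) (x : ZMod m) :
    l * gpI n m x = gpI n m (ZMod.castHom h (ZMod m) l * x) := by
  obtain ⟨k, rfl⟩ := ZMod.natCast_zmod_surjective l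
  obtain ⟨j, rfl⟩ := ZMod.natCast_zmod_surjective x
  rw [map_natCast, ← Nat.cast_mul, gpI_natCast h, gpI_natCast h, ← Nat.cast_mul]
  congr 1; ring

theorem gpI_neg {n m : ℕ} [NeZero n] [NeZero m] (h : m ∣ n) (x : ZMod m) :
    gpI n m (-x) = - gpI n m x := by
  have := gpI_mul h (-1) x
  rw [map_neg, map_one, neg_one_mul, neg_one_mul] at this
  exact this.symm

theorem gpI_inj {n m : ℕ} [NeZero n] [NeZero m] (h : m ∣ n) : Function.Injective (gpI n m) := by
  intro x y hxy
  have := congrArg ZMod.val hxy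
  rw [gpI_val h, gpI_val h] at this
  have h2 : 0 < n / m := Nat.div_pos (Nat.le_of_dvd (NeZero.pos n) h) (NeZero.pos m)
  exact ZMod.val_injective m (Nat.eq_of_mul_eq_mul_left h2 this)

theorem gpI_order {n m : ℕ} [NeZero n] [NeZero m] (h : m ∣ n) (a : ZMod n) :
    addOrderOf a = m ↔ ∃ u : (ZMod m)ˣ, a = gpI n m u := by
  have hn := NeZero.pos n
  have h2 : 0 < n / m := Nat.div_pos (Nat.le_of_dvd (NeZero.pos n) h) (NeZero.pos m)
  have key : ∀ k : ℕ, addOrderOf ((n / m * k : ℕ) : ZMod n) = m / Nat.gcd m k := by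
    intro k
    rw [ZMod.addOrderOf_coe _ hn.ne']
    obtain ⟨t, rfl⟩ := h
    rw [Nat.mul_div_cancel_left _ (NeZero.pos m)] at h2 ⊢
    rw [mul_comm m t, Nat.gcd_mul_left, Nat.mul_div_mul_left _ _ h2]
  constructor
  · intro ho
    have e : a = ((a.val : ℕ) : ZMod n) := (ZMod.natCast_zmod_val a).symm
    have hd : n / m ∣ a.val := by
      rw [e, ZMod.addOrderOf_coe _ hn.ne'] at ho
      have : n / m = n.gcd a.val := by
        rw [← ho, Nat.div_div_self (Nat.gcd_dvd_left _ _) hn.ne']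
      rw [this]; exact Nat.gcd_dvd_right _ _
    obtain ⟨k, hk⟩ := hd
    rw [e, hk, key] at ho
    have hg : Nat.gcd m k = 1 := by
      have hm := NeZero.pos m
      have hdv : Nat.gcd m k ∣ m := Nat.gcd_dvd_left _ _
      have := Nat.div_mul_cancel hdv
      rw [ho] at this
      exact Nat.eq_of_mul_eq_mul_left hm (by simpa using this)
    refine ⟨ZMod.unitOfCoprime k (Nat.Coprime.symm hg), ?_⟩
    rw [ZMod.coe_unitOfCoprime, gpI_natCast h, ← hk, ← e]
  · rintro ⟨u, rfl⟩
    unfold gpI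
    rw [key]
    have : Nat.gcd m (u : ZMod m).val = 1 := (ZMod.val_coe_unit_coprime u).symm
    rw [this, Nat.div_one]

/-- The twisted sums. -/
def gpT {n m : ℕ} [NeZero n] (h : m ∣ n) (χ : DirichletCharacter ℂ m) (a : ZMod n) : ℂ :=
  ∑ l : (ZMod n)ˣ, χ (ZMod.castHom h (ZMod m) l) * (((l : ZMod n) * a).val : ℂ)

theorem gpT_smul {n m : ℕ} [NeZero n] [NeZero m] (h : m ∣ n) (χ : DirichletCharacter ℂ m) (a : ZMod n)
    (l : (ZMod n)ˣ) :
    gpT h χ a = χ (ZMod.castHom h (ZMod m) l) * gpT h χ (l * a) := by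
  unfold gpT
  rw [Finset.mul_sum]
  symm
  refine Fintype.sum_equiv (Equiv.mulRight l) _ _ fun k => ?_
  simp only [Equiv.coe_mulRight, Units.val_mul, map_mul]
  rw [mul_assoc (k : ZMod n)]
  ring

theorem gpT_zero {n m : ℕ} [NeZero n] [NeZero m] (h : m ∣ n) (χ : DirichletCharacter ℂ m)
    (hp : χ.IsPrimitive) (a : ZMod n) (ha : ¬ m ∣ addOrderOf a) : gpT h χ a = 0 := by
  set d := addOrderOf a with hd
  have hdn : d ∣ n := by
    have := addOrderOf_dvd_card (x := a)
    rwa [ZMod.card] at this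
  have hd0 : NeZero d := ⟨fun e => by rw [e] at hdn; exact (NeZero.ne n) (by simpa using hdn)⟩
  have hex : ∃ l : (ZMod n)ˣ, ZMod.unitsMap hdn l = 1 ∧ χ (ZMod.castHom h (ZMod m) l) ≠ 1 := by
    by_contra hcon
    push Not at hcon
    apply ha
    have hf : (DirichletCharacter.changeLevel h χ).FactorsThrough d := by
      rw [DirichletCharacter.factorsThrough_iff_ker_unitsMap hdn]
      intro l hl
      rw [MonoidHom.mem_ker] at hl ⊢
      have := hcon l hl
      ext
      rw [MulChar.coe_toUnitHom, DirichletCharacter.changeLevel_eq_cast_of_dvd]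
      simpa using this
    have hc := DirichletCharacter.conductor_dvd_of_mem_conductorSet _ hf
    rw [DirichletCharacter.conductor_changeLevel] at hc
    rwa [DirichletCharacter.isPrimitive_def _ |>.mp hp] at hc
  obtain ⟨l, hl, hχ⟩ := hex
  have hla : (l : ZMod n) * a = a := by
    obtain ⟨u, hu⟩ := (gpI_order hdn a).mp hd.symm
    rw [hu, gpI_mul hdn]
    have : ZMod.castHom hdn (ZMod d) (l : ZMod n) = 1 := by
      have := congrArg Units.val hl
      rwa [ZMod.unitsMap_val] at this
    rw [this, one_mul]
  have := gpT_smul h χ a l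
  rw [hla] at this
  have h2 : (χ (ZMod.castHom h (ZMod m) l) - 1) * gpT h χ a = 0 := by
    rw [sub_mul, ← this]; ring
  rcases mul_eq_zero.mp h2 with h3 | h3
  · exact absurd (sub_eq_zero.mp h3) hχ
  · exact h3

end GPlevel

section GPlevel2

theorem gp_sum_hom {A B : Type} [Group A] [Group B] [Fintype A] [Fintype B] (φ : A →* B)
    (hφ : Function.Surjective φ) (f : B → ℂ) :
    ∃ k : ℕ, k ≠ 0 ∧ ∑ l, f (φ l) = k * ∑ u, f u := by
  refine ⟨(Finset.univ.filter fun a => φ a = 1).card, ?_, ?_⟩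
  · apply Finset.card_ne_zero_of_mem (a := 1)
    simp
  · rw [← Finset.sum_fiberwise_of_maps_to (s := Finset.univ) (t := Finset.univ) (g := φ) (by simp),
      Finset.mul_sum]
    refine Finset.sum_congr rfl fun u _ => ?_
    rw [Finset.sum_congr rfl (g := fun _ => f u) (by
      intro a ha; rw [(Finset.mem_filter.mp ha).2]), Finset.sum_const, nsmul_eq_mul]
    congr 2
    exact MonoidHom.card_fiber_eq_of_mem_range φ (hφ u) (hφ 1)

theorem gpT_one {n m : ℕ} [NeZero n] [NeZero m] (h : m ∣ n) (χ : DirichletCharacter ℂ m)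
    (hodd : χ.Odd) (hp : χ.IsPrimitive) : gpT h χ (gpI n m 1) ≠ 0 := by
  have h2 : 0 < n / m := Nat.div_pos (Nat.le_of_dvd (NeZero.pos n) h) (NeZero.pos m)
  obtain ⟨k, hk, hsum⟩ := gp_sum_hom (ZMod.unitsMap h) (ZMod.unitsMap_surjective h)
    (fun u : (ZMod m)ˣ => χ (u : ZMod m) * ((u : ZMod m).val : ℂ))
  have e1 : gpT h χ (gpI n m 1) = (n / m : ℕ) *
      ∑ l : (ZMod n)ˣ, χ ((ZMod.unitsMap h l : (ZMod m)ˣ) : ZMod m) *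
        (((ZMod.unitsMap h l : (ZMod m)ˣ) : ZMod m).val : ℂ) := by
    unfold gpT
    rw [Finset.mul_sum]
    refine Finset.sum_congr rfl fun l _ => ?_
    rw [gpI_mul h, gpI_val h, mul_one, ZMod.unitsMap_val]
    push_cast
    simp only [ZMod.castHom_apply]
    ring
  have e2 : ∑ u : (ZMod m)ˣ, χ (u : ZMod m) * ((u : ZMod m).val : ℂ) =
      ∑ j : ZMod m, χ j * (j.val : ℂ) := by
    refine Finset.sum_of_injOn (fun u : (ZMod m)ˣ => (u : ZMod m)) ?_ ?_ ?_ ?_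
    · intro a _ b _ hab; exact Units.ext hab
    · intro a _; simp
    · intro j _ hj
      have : ¬ IsUnit j := by
        rintro ⟨u, rfl⟩; exact hj ⟨u, by simp, rfl⟩
      rw [χ.map_nonunit this, zero_mul]
    · intro u _; rfl
  rw [e1, hsum, e2]
  refine mul_ne_zero (by exact_mod_cast h2.ne') (mul_ne_zero (by exact_mod_cast hk) ?_)
  exact gp_sum_ne_zero χ hodd hp

theorem gpT_unit {n m : ℕ} [NeZero n] [NeZero m] (h : m ∣ n) (χ : DirichletCharacter ℂ m)
    (u : (ZMod m)ˣ) : gpT h χ (gpI n m u) = χ⁻¹ (u : ZMod m) * gpT h χ (gpI n m 1) := by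
  obtain ⟨l, hl⟩ := ZMod.unitsMap_surjective h u
  have hl' : ZMod.castHom h (ZMod m) (l : ZMod n) = u := by
    have := congrArg Units.val hl
    rwa [ZMod.unitsMap_val] at this
  have := gpT_smul h χ (gpI n m 1) l
  rw [gpI_mul h, hl', mul_one] at this
  rw [this, ← mul_assoc, MulChar.inv_apply_eq_inv', inv_mul_cancel₀, one_mul]
  exact (u.isUnit.map χ).ne_zero

theorem gp_rel {n m : ℕ} [NeZero n] [NeZero m] (h : m ∣ n) (c : ZMod n → ℤ)
    (hanti : ∀ a, c (-a) = - c a)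
    (hrel : ∀ l : (ZMod n)ˣ, ∑ a, c a * (((l : ZMod n) * a).val : ℤ) = 0)
    (hmax : ∀ a, c a ≠ 0 → m ∣ addOrderOf a → addOrderOf a = m)
    (χ : DirichletCharacter ℂ m) (hp : χ.IsPrimitive) :
    ∑ u : (ZMod m)ˣ, (c (gpI n m u) : ℂ) * χ (u : ZMod m) = 0 := by
  rcases DirichletCharacter.even_or_odd χ with hev | hodd
  · have e : ∑ u : (ZMod m)ˣ, (c (gpI n m u) : ℂ) * χ (u : ZMod m) =
        - ∑ u : (ZMod m)ˣ, (c (gpI n m u) : ℂ) * χ (u : ZMod m) := by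
      rw [← Finset.sum_neg_distrib]
      refine Fintype.sum_equiv (Equiv.neg _) _ _ fun u => ?_
      simp only [Equiv.neg_apply, Units.val_neg]
      rw [gpI_neg h, hanti, hev.eval_neg]
      push_cast; ring
    have h2 : (2 : ℂ) * ∑ u : (ZMod m)ˣ, (c (gpI n m u) : ℂ) * χ (u : ZMod m) = 0 := by
      linear_combination e
    simpa using h2
  · have hpi : (χ⁻¹).IsPrimitive := by
      rw [DirichletCharacter.isPrimitive_def] at hp ⊢
      rw [DirichletCharacter.conductor_inv, hp]
    have hχi : (χ⁻¹).Odd := by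
      have : χ (-1) = -1 := hodd
      have h2 : χ⁻¹ (-1) = -1 := by
        rw [MulChar.inv_apply_eq_inv', this]; norm_num
      exact h2
    have s1 : ∑ a, (c a : ℂ) * gpT h χ⁻¹ a = 0 := by
      unfold gpT
      simp only [Finset.mul_sum]
      rw [Finset.sum_comm]
      refine Finset.sum_eq_zero fun l _ => ?_
      have := hrel l
      have h3 : ∑ a, (c a : ℂ) * (((l : ZMod n) * a).val : ℂ) = 0 := by exact_mod_cast this
      calc ∑ a, (c a : ℂ) * (χ⁻¹ (ZMod.castHom h (ZMod m) l) * (((l : ZMod n) * a).val : ℂ))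
          = χ⁻¹ (ZMod.castHom h (ZMod m) l) * ∑ a, (c a : ℂ) * (((l : ZMod n) * a).val : ℂ) := by
            rw [Finset.mul_sum]; refine Finset.sum_congr rfl fun a _ => ?_; ring
        _ = 0 := by rw [h3, mul_zero]
    have s2 : ∑ u : (ZMod m)ˣ, (c (gpI n m u) : ℂ) * gpT h χ⁻¹ (gpI n m u) =
        ∑ a, (c a : ℂ) * gpT h χ⁻¹ a := by
      refine Finset.sum_of_injOn (fun u : (ZMod m)ˣ => gpI n m u) ?_ ?_ ?_ ?_
      · intro a _ b _ hab; exact Units.ext (gpI_inj h hab)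
      · intro a _; simp
      · intro a _ ha
        by_cases hca : c a = 0
        · simp [hca]
        by_cases hma : m ∣ addOrderOf a
        · exfalso
          obtain ⟨u, hu⟩ := (gpI_order h a).mp (hmax a hca hma)
          exact ha ⟨u, by simp, hu.symm⟩
        · rw [gpT_zero h _ hpi a hma, mul_zero]
      · intro u _; rfl
    rw [s1] at s2
    simp only [gpT_unit h, inv_inv] at s2
    have s3 : (∑ u : (ZMod m)ˣ, (c (gpI n m u) : ℂ) * χ (u : ZMod m)) *
        gpT h χ⁻¹ (gpI n m 1) = 0 := by
      rw [← s2, Finset.sum_mul]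
      refine Finset.sum_congr rfl fun u _ => ?_
      ring
    rcases mul_eq_zero.mp s3 with h0 | h0
    · exact h0
    · exact absurd h0 (gpT_one h _ hχi hpi)

/-- kernel of reduction modulo `d` (trivial value if `d` does not divide `m`) -/
def gpKer (m d : ℕ) : Subgroup (ZMod m)ˣ :=
  if h : d ∣ m then (ZMod.unitsMap h).ker else ⊥

theorem gpKer_mem {m d : ℕ} [NeZero m] (h : d ∣ m) (u : (ZMod m)ˣ) :
    u ∈ gpKer m d ↔ ((u : ZMod m).val : ZMod d) = 1 := by
  unfold gpKer
  rw [dif_pos h, MonoidHom.mem_ker, Units.ext_iff, ZMod.unitsMap_val, Units.val_one]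
  rw [ZMod.natCast_val]

theorem gp_prim {m : ℕ} [NeZero m] (χ : DirichletCharacter ℂ m)
    (hχ : ∀ q, q.Prime → q ∣ m → ∃ h ∈ gpKer m (m / q), χ (h : ZMod m) ≠ 1) : χ.IsPrimitive := by
  rw [DirichletCharacter.isPrimitive_def]
  by_contra hne
  have hd := DirichletCharacter.conductor_dvd_level χ
  obtain ⟨t, ht⟩ := hd
  have ht1 : t ≠ 1 := by
    rintro rfl; rw [mul_one] at ht; exact hne ht.symm
  obtain ⟨q, hq, hqt⟩ := Nat.exists_prime_and_dvd ht1
  obtain ⟨s, hs⟩ := hqt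
  have hmq : m = q * (χ.conductor * s) := by
    refine ht.trans ?_
    rw [hs]; ring
  have hqm : q ∣ m := ⟨_, hmq⟩
  obtain ⟨g, hg, hg1⟩ := hχ q hq hqm
  have hdiv : m / q = χ.conductor * s := by
    exact Nat.div_eq_of_eq_mul_right hq.pos hmq
  have hdm : m / q ∣ m := Nat.div_dvd_of_dvd hqm
  have hf : χ.FactorsThrough (m / q) :=
    (DirichletCharacter.factorsThrough_conductor χ).mono χ (by rw [hdiv]; exact dvd_mul_right _ _) hdm
  rw [DirichletCharacter.factorsThrough_iff_ker_unitsMap hdm] at hf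
  unfold gpKer at hg
  rw [dif_pos hdm] at hg
  have := hf hg
  rw [MonoidHom.mem_ker] at this
  apply hg1
  have := congrArg Units.val this
  rwa [MulChar.coe_toUnitHom, Units.val_one] at this

end GPlevel2

section GPstruct

/-- The subgroups `H_q`. -/
def gpH (m q : ℕ) : Subgroup (ZMod m)ˣ := gpKer m (m / q)

/-- The subgroups `K_q`. -/
def gpK (m q : ℕ) : Subgroup (ZMod m)ˣ := gpKer m (q ^ m.factorization q)

theorem gp_killed {n m : ℕ} [NeZero n] [NeZero m] (h : m ∣ n) (c : ZMod n → ℤ)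
    (hanti : ∀ a, c (-a) = - c a)
    (hrel : ∀ l : (ZMod n)ˣ, ∑ a, c a * (((l : ZMod n) * a).val : ℤ) = 0)
    (hmax : ∀ a, c a ≠ 0 → m ∣ addOrderOf a → addOrderOf a = m)
    (L : List ℕ) (hL : ∀ q, q.Prime → q ∣ m → q ∈ L) :
    gpKilled (gpH m) L (fun u : (ZMod m)ˣ => c (gpI n m u)) := by
  apply gp_orth_killed
  intro χ hχ
  exact gp_rel h c hanti hrel hmax χ (gp_prim χ fun q hq hqm => hχ q (hL q hq hqm))

theorem gpKer_mem_iff {m d : ℕ} [NeZero m] (h : d ∣ m) (u : (ZMod m)ˣ) :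
    u ∈ gpKer m d ↔ (u : ZMod m).val ≡ 1 [MOD d] := by
  rw [gpKer_mem h, ← ZMod.natCast_eq_natCast_iff, Nat.cast_one]

theorem gpKer_mono {m d d' : ℕ} [NeZero m] (h : d ∣ m) (hd : d' ∣ d) : gpKer m d ≤ gpKer m d' := by
  intro u hu
  rw [gpKer_mem_iff h] at hu
  rw [gpKer_mem_iff (hd.trans h)]
  exact hu.of_dvd hd

theorem gpKer_inf {m d d' : ℕ} [NeZero m] (h : d ∣ m) (h' : d' ∣ m) (hl : m ∣ Nat.lcm d d') :
    gpKer m d ⊓ gpKer m d' = ⊥ := by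
  rw [eq_bot_iff]
  rintro u ⟨h1, h2⟩
  have h1 := (gpKer_mem_iff h u).mp h1
  have h2 := (gpKer_mem_iff h' u).mp h2
  have h3 : (u : ZMod m).val ≡ 1 [MOD m] := by
    rw [Nat.modEq_iff_dvd] at *
    have : (Nat.lcm d d' : ℤ) ∣ ((1 : ℕ) : ℤ) - ((u : ZMod m).val : ℤ) := by
      have := Int.coe_lcm_dvd h1 h2
      simpa [Int.lcm] using this
    exact dvd_trans (by exact_mod_cast hl) this
  rw [Subgroup.mem_bot]
  rw [← ZMod.natCast_eq_natCast_iff, ZMod.natCast_zmod_val] at h3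
  exact Units.ext (by simpa using h3)

theorem gpH_inf_K {m q : ℕ} [NeZero m] (hq : q.Prime) (hqm : q ∣ m) : gpH m q ⊓ gpK m q = ⊥ := by
  have hm := NeZero.ne m
  refine gpKer_inf (Nat.div_dvd_of_dvd hqm) (Nat.ordProj_dvd m q) ?_
  have hco : Nat.Coprime (q ^ m.factorization q) (m / q ^ m.factorization q) :=
    (Nat.coprime_ordCompl hq hm).pow_left _
  have e := Nat.ordProj_mul_ordCompl_eq_self m q
  have hk : 1 ≤ m.factorization q := (hq.dvd_iff_one_le_factorization hm).mp hqm
  have h2 : m / q ^ m.factorization q ∣ m / q := by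
    obtain ⟨k, hk'⟩ : ∃ k, m.factorization q = k + 1 := ⟨m.factorization q - 1, by omega⟩
    generalize m / q ^ m.factorization q = r at e
    refine ⟨q ^ k, ?_⟩
    rw [hk'] at e
    refine Nat.div_eq_of_eq_mul_right hq.pos ?_
    rw [← e, pow_succ]; ring
  calc m = q ^ m.factorization q * (m / q ^ m.factorization q) := e.symm
    _ ∣ Nat.lcm (m / q) (q ^ m.factorization q) :=
      hco.mul_dvd_of_dvd_of_dvd (Nat.dvd_lcm_right _ _) (h2.trans (Nat.dvd_lcm_left _ _))

theorem gpH_le_K {m i j : ℕ} [NeZero m] (hi : i.Prime) (hj : j.Prime) (hjm : j ∣ m)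
    (hij : i ≠ j) : gpH m j ≤ gpK m i := by
  refine gpKer_mono (Nat.div_dvd_of_dvd hjm) ?_
  obtain ⟨t, ht⟩ := hjm
  have e : m / j = t := by rw [ht]; exact Nat.mul_div_cancel_left _ hj.pos
  rw [e]
  have := Nat.ordProj_dvd m i
  nth_rw 2 [ht] at this
  have hco : Nat.Coprime (i ^ m.factorization i) j :=
    Nat.Coprime.pow_left _ ((Nat.coprime_primes hi hj).mpr hij)
  exact hco.dvd_of_dvd_mul_left this

theorem gpKer_card {m d : ℕ} [NeZero m] (h : d ∣ m) :
    d.totient * Nat.card (gpKer m d) = m.totient := by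
  have hd : NeZero d := ⟨fun e => by rw [e] at h; exact (NeZero.ne m) (by simpa using h)⟩
  have h1 := Subgroup.card_mul_index (gpKer m d)
  have h2 : (gpKer m d).index = d.totient := by
    unfold gpKer
    rw [dif_pos h, Subgroup.index_ker, MonoidHom.range_eq_top.mpr (ZMod.unitsMap_surjective h),
      Nat.card_congr Subgroup.topEquiv.toEquiv, Nat.card_eq_fintype_card, ZMod.card_units_eq_totient]
  rw [h2, Nat.card_eq_fintype_card (α := (ZMod m)ˣ), ZMod.card_units_eq_totient] at h1
  rw [mul_comm]; exact h1

theorem gpH_card {m q : ℕ} [NeZero m] (hq : q.Prime) (hqm : q ∣ m) :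
    Nat.card (gpH m q) = if q ∣ m / q then q else q - 1 := by
  have hd := Nat.div_dvd_of_dvd hqm
  have h1 := gpKer_card hd
  have e : m = q * (m / q) := (Nat.mul_div_cancel' hqm).symm
  have hpos : 0 < (m / q).totient := by
    rw [Nat.totient_pos]
    exact Nat.div_pos (Nat.le_of_dvd (NeZero.pos m) hqm) hq.pos
  apply Nat.eq_of_mul_eq_mul_left hpos
  unfold gpH
  rw [h1]
  split_ifs with h
  · conv_lhs => rw [e]
    rw [Nat.totient_mul_of_prime_of_dvd hq h, mul_comm]
  · conv_lhs => rw [e]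
    rw [Nat.totient_mul_of_prime_of_not_dvd hq h, mul_comm]

theorem gp_sys {m : ℕ} [NeZero m] (hm : ∀ q, q.Prime → q ∣ m → 5 ≤ q) (L : List ℕ) (hnd : L.Nodup)
    (hL : ∀ q ∈ L, q.Prime ∧ q ∣ m) : gpSys (gpH m) (gpK m) L := by
  refine ⟨hnd, fun i hi => gpH_inf_K (hL i hi).1 (hL i hi).2,
    fun i hi j hj hij => gpH_le_K (hL i hi).1 (hL j hj).1 (hL j hj).2 hij, fun i hi => ?_⟩
  rw [gpH_card (hL i hi).1 (hL i hi).2]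
  have := hm i (hL i hi).1 (hL i hi).2
  split_ifs <;> omega

theorem gp_neg_one_not_K {m p : ℕ} [NeZero m] (hp : p.Prime) (hpm : p ∣ m) (h5 : 5 ≤ p) :
    (-1 : (ZMod m)ˣ) ∉ gpK m p := by
  have hm1 : p ≤ m := Nat.le_of_dvd (NeZero.pos m) hpm
  have hk : 1 ≤ m.factorization p := (hp.dvd_iff_one_le_factorization (NeZero.ne m)).mp hpm
  intro h
  have h1 := (gpKer_mem (Nat.ordProj_dvd m p) _).mp h
  have hdp : p ∣ p ^ m.factorization p := dvd_pow_self _ (by omega)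
  have h2 : ((-1 : ZMod m).val) ≡ 1 [MOD p] := by
    have := (gpKer_mem_iff (Nat.ordProj_dvd m p) _).mp h
    exact (this.of_dvd hdp)
  obtain ⟨k, rfl⟩ : ∃ k, m = k + 1 := ⟨m - 1, by omega⟩
  rw [ZMod.val_neg_one] at h2
  have h3 : k + 1 ≡ 0 [MOD p] := Nat.modEq_zero_iff_dvd.mpr hpm
  have h4 : 0 ≡ 2 [MOD p] := h3.symm.trans (h2.add_right 1)
  have : p ∣ 2 := (Nat.modEq_zero_iff_dvd.mp h4.symm)
  have := Nat.le_of_dvd (by norm_num) this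
  omega

theorem gpKer_smul {m d : ℕ} [NeZero m] (h : d ∣ m) (u a : (ZMod m)ˣ) (hu : u * a⁻¹ ∈ gpKer m d) :
    ((m / d : ℕ) : ZMod m) * u = ((m / d : ℕ) : ZMod m) * a := by
  set g := u * a⁻¹ with hg
  have hug : u = g * a := by rw [hg]; simp
  have h1 := (gpKer_mem_iff h g).mp hu
  have h2 := h1.mul_left' (m / d)
  rw [Nat.div_mul_cancel h, ← ZMod.natCast_eq_natCast_iff, Nat.cast_mul, ZMod.natCast_zmod_val,
    mul_one] at h2
  rw [hug, Units.val_mul, ← mul_assoc, h2]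

theorem gpI_smul {n m : ℕ} [NeZero n] [NeZero m] (h : m ∣ n) (k : ℕ) (x : ZMod m) :
    (k : ZMod n) * gpI n m x = gpI n m ((k : ZMod m) * x) := by
  rw [gpI_mul h, map_natCast]

end GPstruct

section GPtri

/-- First alternative of the classification. -/
def gpAlpha (m : ℕ) [NeZero m] (c : (ZMod m)ˣ → ℤ) : Prop :=
  ∃ (N : ℕ) (a : (ZMod m)ˣ), c a ≠ 0 ∧ (N : ZMod m) * a ≠ 0 ∧
    (∀ u, c u ≠ 0 → (N : ZMod m) * u = N * a ∨ (N : ZMod m) * u = -(N * a)) ∧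
    (gpN c ≤ 8 → 5 ∣ m ∧ ¬ 5 ∣ m / 5 ∧ m ≠ 5 ∧ ∃ ε : ℤ, (ε = 1 ∨ ε = -1) ∧
      ∀ u, c u = (if u * a⁻¹ ∈ gpH m 5 then ε else 0) -
        (if u * (-1 * a)⁻¹ ∈ gpH m 5 then ε else 0))

theorem gp_natCast_mul_ne {m : ℕ} [NeZero m] {N : ℕ} (h0 : 0 < N) (hN : N < m) (a : (ZMod m)ˣ) :
    (N : ZMod m) * a ≠ 0 := by
  intro h
  rw [Units.mul_left_eq_zero, ZMod.natCast_eq_zero_iff] at h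
  have := Nat.le_of_dvd h0 h
  omega

theorem gp_alpha1 {m : ℕ} [NeZero m] {c : (ZMod m)ˣ → ℤ} (hanti : ∀ u, c (-1 * u) = - c u)
    {q : ℕ} (hq : q.Prime) (hqm : q ∣ m) (hcard : 5 ≤ Nat.card (gpH m q)) {a : (ZMod m)ˣ}
    (ha : c a ≠ 0) (hinv : ∀ h ∈ gpH m q, c (h * a) = c a)
    (hsup : (-1 : (ZMod m)ˣ) ∉ gpH m q → ∀ b, b * a⁻¹ ∉ gpH m q → b * (-1 * a)⁻¹ ∉ gpH m q → c b = 0) :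
    gpAlpha m c := by
  have heH : (-1 : (ZMod m)ˣ) ∉ gpH m q := by
    intro h
    have h1 := hinv _ h
    rw [hanti] at h1
    omega
  have hdm := Nat.div_dvd_of_dvd hqm
  have hmq : m ≠ q := by
    intro e
    apply heH
    unfold gpH
    rw [gpKer_mem_iff hdm]
    have : m / q = 1 := by rw [e]; exact Nat.div_self hq.pos
    rw [this]
    exact Nat.modEq_one
  have hlt : q < m := lt_of_le_of_ne (Nat.le_of_dvd (NeZero.pos m) hqm) (Ne.symm hmq)
  have hdd : m / (m / q) = q := Nat.div_div_self hqm (NeZero.ne m)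
  refine ⟨q, a, ha, gp_natCast_mul_ne hq.pos hlt a, ?_, ?_⟩
  · intro u hu
    by_cases h1 : u * a⁻¹ ∈ gpH m q
    · left
      have := gpKer_smul hdm u a h1
      rwa [hdd] at this
    by_cases h2 : u * (-1 * a)⁻¹ ∈ gpH m q
    · right
      have := gpKer_smul hdm u (-1 * a) h2
      rw [hdd] at this
      rw [this]; simp
    · exact absurd (hsup heH u h1 h2) hu
  · intro h8
    have := (gpInv (gpH m q) (by simp) heH hanti ha hinv).1
    omega

theorem gp_tri {m : ℕ} [NeZero m] (hm : ∀ q, q.Prime → q ∣ m → 5 ≤ q)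
    (c : (ZMod m)ˣ → ℤ) (hanti : ∀ u, c (-1 * u) = - c u)
    (hkill : ∀ L : List ℕ, (∀ q, q.Prime → q ∣ m → q ∈ L) → gpKilled (gpH m) L c)
    (hne : ∃ u, c u ≠ 0) (hN : gpN c ≤ 12) :
    gpAlpha m c ∨ (m = 35 ∧ 12 ≤ gpN c) := by
  obtain ⟨a0, ha0⟩ := hne
  have hee : (-1 : (ZMod m)ˣ) * -1 = 1 := by simp
  have hm1 : m ≠ 1 := by
    rintro rfl
    have h1 := hanti a0
    rw [show -1 * a0 = a0 from Subsingleton.elim _ _] at h1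
    omega
  have hpf : m.primeFactors.Nonempty := by
    obtain ⟨p, hp, hpm⟩ := Nat.exists_prime_and_dvd hm1
    exact ⟨p, Nat.mem_primeFactors.mpr ⟨hp, hpm, NeZero.ne m⟩⟩
  obtain ⟨p, hpmem, hpmax⟩ := Finset.exists_max_image m.primeFactors id hpf
  obtain ⟨hp, hpm, _⟩ := Nat.mem_primeFactors.mp hpmem
  have hmax : ∀ q, q.Prime → q ∣ m → q ≤ p := fun q hq hqm =>
    hpmax q (Nat.mem_primeFactors.mpr ⟨hq, hqm, NeZero.ne m⟩)
  have hp5 := hm p hp hpm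
  by_cases hp7 : p < 7
  · left
    have hp6 : p ≠ 6 := by rintro rfl; exact absurd hp (by norm_num)
    have hp5' : p = 5 := by omega
    subst hp5'
    have honly : ∀ q, q.Prime → q ∣ m → q = 5 := fun q hq hqm =>
      le_antisymm (hmax q hq hqm) (hm q hq hqm)
    have hk := hkill [5] (fun q hq hqm => by simp [honly q hq hqm])
    have hinv : ∀ b, ∀ h ∈ gpH m 5, c (h * b) = c b := by
      intro b h hh
      have := hk h hh b
      simp only at this
      omega
    have heH : (-1 : (ZMod m)ˣ) ∉ gpH m 5 := by
      intro h
      have h1 := hinv a0 _ h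
      rw [hanti] at h1
      omega
    have hcard : 5 ≤ Nat.card (gpH m 5) := by
      rw [gpH_card hp hpm]
      split_ifs with h
      · exact le_rfl
      · exfalso
        have : m / 5 = 1 := by
          by_contra h1
          obtain ⟨q, hq, hqd⟩ := Nat.exists_prime_and_dvd h1
          have := honly q hq (hqd.trans (Nat.div_dvd_of_dvd hpm))
          rw [this] at hqd
          exact h hqd
        apply heH
        unfold gpH
        rw [gpKer_mem_iff (Nat.div_dvd_of_dvd hpm), this]
        exact Nat.modEq_one
    refine gp_alpha1 hanti hp hpm hcard ha0 (hinv a0) ?_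
    intro _ b h1 h2
    by_contra hb
    have := (gpInv (gpH m 5) hee heH hanti ha0 (hinv a0)).2.2 b h1 h2 hb (hinv b)
    omega
  · have hp7' : 7 ≤ p := by omega
    set L := (m.primeFactors.erase p).toList with hL
    have hLmem : ∀ q ∈ L, q.Prime ∧ q ∣ m ∧ q ≠ p := by
      intro q hq
      rw [hL, Finset.mem_toList, Finset.mem_erase, Nat.mem_primeFactors] at hq
      exact ⟨hq.2.1, hq.2.2.1, hq.1⟩
    have hLmem' : ∀ q, q.Prime → q ∣ m → q ≠ p → q ∈ L := by
      intro q hq hqm hqp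
      rw [hL, Finset.mem_toList, Finset.mem_erase, Nat.mem_primeFactors]
      exact ⟨hqp, hq, hqm, NeZero.ne m⟩
    have hnd : (p :: L).Nodup := by
      rw [List.nodup_cons]
      exact ⟨fun h => (hLmem p h).2.2 rfl, Finset.nodup_toList _⟩
    have hS : gpSys (gpH m) (gpK m) (p :: L) := by
      refine gp_sys hm _ hnd ?_
      intro q hq
      rcases List.mem_cons.mp hq with rfl | h
      · exact ⟨hp, hpm⟩
      · exact ⟨(hLmem q h).1, (hLmem q h).2.1⟩
    have hk := hkill (p :: L) (fun q hq hqm => by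
      by_cases h : q = p
      · simp [h]
      · exact List.mem_cons_of_mem _ (hLmem' q hq hqm h))
    by_cases hcase : ∃ x, ∀ y ∈ gpCos (gpH m p) x, ∃ u, gpSl (gpK m p) y c u ≠ 0
    · obtain ⟨x, hx⟩ := hcase
      have hB := gpB hS hee hanti hk hx
      have hc6 : Nat.card (gpH m p) ≤ 6 := by
        have := hB.1
        omega
      have hcd := gpH_card hp hpm
      have hnp : ¬ p ∣ m / p := by
        intro h; rw [if_pos h] at hcd; omega
      rw [if_neg hnp] at hcd
      have hp77 : p = 7 := by omega
      subst hp77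
      have hcd6 : Nat.card (gpH m 7) = 6 := hcd
      rw [hcd6] at hB
      by_cases h5 : ∀ i ∈ L, 5 ≤ Nat.card (gpH m i)
      · left
        obtain ⟨a, ha, hinv⟩ := hB.2 (by norm_num; linarith) h5
        refine gp_alpha1 hanti hp hpm (by omega) ha hinv ?_
        intro heH b h1 h2
        have := (gpInv (gpH m 7) hee heH hanti ha hinv).2.1 b h1 h2
        rw [hcd6] at this
        have h0 := abs_nonneg (c b)
        have : |c b| = 0 := by push_cast at this; omega
        simpa using this
      · right
        push Not at h5
        obtain ⟨i, hi, hi5⟩ := h5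
        obtain ⟨hip, him, hi7⟩ := hLmem i hi
        have hi5' := hm i hip him
        have hi6 := hmax i hip him
        have hi66 : i ≠ 6 := by rintro rfl; exact absurd hip (by norm_num)
        have hi55 : i = 5 := by omega
        subst hi55
        have hcd5 := gpH_card hip him
        have h55 : ¬ 5 ∣ m / 5 := by
          intro h; rw [if_pos h] at hcd5; omega
        refine ⟨?_, by have := hB.1; norm_num at this; exact this⟩
        have h35 : 35 ∣ m := by
          have : Nat.Coprime 5 7 := by norm_num
          exact this.mul_dvd_of_dvd_of_dvd him hpm
        obtain ⟨r, hr⟩ := h35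
        have hr1 : r = 1 := by
          by_contra h1
          obtain ⟨q, hq, hqd⟩ := Nat.exists_prime_and_dvd h1
          have hqm : q ∣ m := by rw [hr]; exact hqd.mul_left _
          have b1 := hm q hq hqm
          have b2 := hmax q hq hqm
          have b3 : q ≠ 6 := by rintro rfl; exact absurd hq (by norm_num)
          obtain ⟨s, hs⟩ := hqd
          have : q = 5 ∨ q = 7 := by omega
          rcases this with rfl | rfl
          · apply h55; rw [hr, hs]
            exact ⟨7 * s, by omega⟩
          · apply hnp; rw [hr, hs]
            exact ⟨5 * s, by omega⟩
        rw [hr, hr1]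
    · left
      push Not at hcase
      have heK := gp_neg_one_not_K hp hpm hp5
      obtain ⟨hA1, hA2⟩ := gpA hS hee heK hanti hk hN hcase ha0
      have hPd := Nat.ordProj_dvd m p
      have hdd : 0 < m / p ^ m.factorization p :=
        Nat.div_pos (Nat.le_of_dvd (NeZero.pos m) hPd) (pow_pos hp.pos _)
      have hkk : 1 ≤ m.factorization p := (hp.dvd_iff_one_le_factorization (NeZero.ne m)).mp hpm
      refine ⟨m / p ^ m.factorization p, a0, ha0, ?_, ?_, ?_⟩
      · apply gp_natCast_mul_ne hdd
        exact Nat.div_lt_self (NeZero.pos m) (Nat.one_lt_pow (by omega) hp.one_lt)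
      · intro u hu
        rcases hA1 u hu with h | h
        · left; exact gpKer_smul hPd u a0 h
        · right
          rw [gpKer_smul hPd u (-1 * a0) h]
          simp
      · intro h8
        obtain ⟨i, hi, hi4, b, ε, hε, hf⟩ := hA2 h8
        obtain ⟨hip, him, hipp⟩ := hLmem i hi
        have hcd := gpH_card hip him
        have hi5 := hm i hip him
        have hnd5 : ¬ i ∣ m / i := by
          intro h; rw [if_pos h] at hcd; omega
        rw [if_neg hnd5] at hcd
        have : i = 5 := by omega
        subst this
        refine ⟨him, hnd5, ?_, ε, hε, ?_⟩
        · rintro rfl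
          have : p ≤ 5 := Nat.le_of_dvd (by norm_num) hpm
          omega
        · have hHK : gpH m 5 ≤ gpK m p := gpH_le_K hp hip him (Ne.symm hipp)
          have hab : a0 * b⁻¹ ∈ gpH m 5 := by
            by_contra h
            have := hf a0
            rw [gpSl_self, if_neg h] at this
            exact ha0 this
          have hiff : ∀ u, u * b⁻¹ ∈ gpH m 5 ↔ u * a0⁻¹ ∈ gpH m 5 := by
            intro u
            have e : u * b⁻¹ = u * a0⁻¹ * (a0 * b⁻¹) := by
              rw [mul_assoc, inv_mul_cancel_left]
            rw [e]; exact Subgroup.mul_mem_cancel_right _ hab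
          have hon : ∀ u, u * a0⁻¹ ∈ gpK m p → c u = if u * a0⁻¹ ∈ gpH m 5 then ε else 0 := by
            intro u hu
            have := hf u
            simp only [gpSl, hu, if_true, hiff] at this
            exact this
          have sw1 : ∀ x y : (ZMod m)ˣ, x * (-1 * y)⁻¹ = -1 * (x * y⁻¹) := by
            intro x y; simp
          have hexcl : ∀ g : (ZMod m)ˣ, g ∈ gpK m p → -1 * g ∉ gpK m p := by
            intro g hg h
            exact heK ((Subgroup.mul_mem_cancel_right _ hg).mp h)
          intro u
          rw [sw1]
          by_cases h1 : u * a0⁻¹ ∈ gpK m p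
          · have h2 : -1 * (u * a0⁻¹) ∉ gpH m 5 := fun h => hexcl _ h1 (hHK h)
            rw [if_neg h2, sub_zero]; exact hon u h1
          · have h1' : u * a0⁻¹ ∉ gpH m 5 := fun h => h1 (hHK h)
            rw [if_neg h1', zero_sub]
            by_cases h2 : -1 * (u * a0⁻¹) ∈ gpK m p
            · have h3 := hon (-1 * u) (by rwa [mul_assoc])
              rw [hanti, mul_assoc] at h3
              omega
            · have h2' : -1 * (u * a0⁻¹) ∉ gpH m 5 := fun h => h2 (hHK h)
              rw [if_neg h2', neg_zero]
              by_contra hu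
              rcases hA1 u hu with h | h
              · exact h1 h
              · rw [sw1] at h; exact h2 h

end GPtri

section GP35

/-- Dual weights for the modulus 35. -/
def gpF35 (w : ZMod 35) : ℤ :=
  -((1 * w).val : ℤ) - ((2 * w).val : ℤ) - ((3 * w).val : ℤ) + ((4 * w).val : ℤ)
    - ((6 * w).val : ℤ) - ((8 * w).val : ℤ) - ((9 * w).val : ℤ) - ((11 * w).val : ℤ)
    + ((12 * w).val : ℤ) - ((13 * w).val : ℤ) - ((16 * w).val : ℤ) - ((17 * w).val : ℤ)

theorem gpF35_one : gpF35 1 - gpF35 (-1) = 140 := by decide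

theorem gpF35_other : ∀ w : ZMod 35, Nat.gcd w.val 35 = 1 → w ≠ 1 → w ≠ -1 →
    gpF35 w - gpF35 (-w) = 0 := by
  set_option maxRecDepth 100000 in decide

theorem gp35 (c : (ZMod 35)ˣ → ℤ) (hanti : ∀ u, c (-1 * u) = - c u)
    (hrel : ∀ l : (ZMod 35)ˣ, ∑ u, c u * (((l * u : (ZMod 35)ˣ) : ZMod 35).val : ℤ) = 0)
    (v : (ZMod 35)ˣ) : c v = 0 := by
  have hk : ∀ k : ℕ, Nat.Coprime k 35 →
      ∑ u, c u * (((k : ZMod 35) * ((v⁻¹ * u : (ZMod 35)ˣ) : ZMod 35)).val : ℤ) = 0 := by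
    intro k hk
    rw [← hrel (ZMod.unitOfCoprime k hk * v⁻¹)]
    refine Finset.sum_congr rfl fun u _ => ?_
    rw [mul_assoc]
    simp only [Units.val_mul, ZMod.coe_unitOfCoprime]
  have hS : ∑ u, c u * gpF35 ((v⁻¹ * u : (ZMod 35)ˣ) : ZMod 35) = 0 := by
    have h1 := hk 1 (by decide)
    have h2 := hk 2 (by decide)
    have h3 := hk 3 (by decide)
    have h4 := hk 4 (by decide)
    have h6 := hk 6 (by decide)
    have h8 := hk 8 (by decide)
    have h9 := hk 9 (by decide)
    have h11 := hk 11 (by decide)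
    have h12 := hk 12 (by decide)
    have h13 := hk 13 (by decide)
    have h16 := hk 16 (by decide)
    have h17 := hk 17 (by decide)
    push_cast at h1 h2 h3 h4 h6 h8 h9 h11 h12 h13 h16 h17
    simp only [gpF35, mul_sub, mul_add, mul_neg, Finset.sum_sub_distrib, Finset.sum_add_distrib,
      Finset.sum_neg_distrib]
    push_cast
    linarith
  have hS2 : ∑ u, c u * gpF35 (-((v⁻¹ * u : (ZMod 35)ˣ) : ZMod 35)) = 0 := by
    rw [← Equiv.sum_comp (Equiv.mulLeft (-1 : (ZMod 35)ˣ))]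
    have : ∀ u, c ((Equiv.mulLeft (-1 : (ZMod 35)ˣ)) u) *
        gpF35 (-((v⁻¹ * (Equiv.mulLeft (-1 : (ZMod 35)ˣ)) u : (ZMod 35)ˣ) : ZMod 35)) =
        - (c u * gpF35 ((v⁻¹ * u : (ZMod 35)ˣ) : ZMod 35)) := by
      intro u
      rw [Equiv.coe_mulLeft, hanti]
      have : -((v⁻¹ * (-1 * u) : (ZMod 35)ˣ) : ZMod 35) = ((v⁻¹ * u : (ZMod 35)ˣ) : ZMod 35) := by
        push_cast; ring
      rw [this]; ring
    rw [Finset.sum_congr rfl fun u _ => this u, Finset.sum_neg_distrib, hS, neg_zero]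
  have hD : ∑ u, c u * (gpF35 ((v⁻¹ * u : (ZMod 35)ˣ) : ZMod 35) -
      gpF35 (-((v⁻¹ * u : (ZMod 35)ˣ) : ZMod 35))) = 0 := by
    simp only [mul_sub, Finset.sum_sub_distrib]
    rw [hS, hS2, sub_zero]
  have hne : v ≠ -1 * v := by
    intro h
    have h1 : (1 : (ZMod 35)ˣ) = -1 := by
      have := mul_right_cancel (b := v) (a := 1) (c := -1) (by rw [one_mul]; exact h)
      exact this
    have := congrArg Units.val h1
    revert this
    push_cast
    decide
  rw [← Finset.sum_subset (Finset.subset_univ {v, -1 * v}), Finset.sum_pair hne, hanti] at hD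
  · have e1 : v⁻¹ * v = 1 := by group
    have e2 : v⁻¹ * (-1 * v) = -1 := by simp
    rw [e1, e2] at hD
    have h1 := gpF35_one
    push_cast at hD
    rw [neg_neg] at hD
    have : c v * (gpF35 1 - gpF35 (-1)) = 0 := by linarith
    rw [h1] at this
    omega
  · intro u _ hu
    simp only [Finset.mem_insert, Finset.mem_singleton, not_or] at hu
    rw [gpF35_other, mul_zero]
    · exact ZMod.val_coe_unit_coprime _
    · intro h
      apply hu.1
      have : v⁻¹ * u = 1 := Units.ext h
      exact (inv_mul_eq_one.mp this).symm
    · intro h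
      apply hu.2
      have : v⁻¹ * u = -1 := Units.ext (by rw [h]; simp)
      rw [inv_mul_eq_iff_eq_mul] at this
      rw [this, mul_comm]

end GP35

section GPmain

/-- The antisymmetrised counting function of two triples. -/
def gpC {n : ℕ} (a : Fin 2 → Fin 3 → ZMod n) (x : ZMod n) : ℤ :=
  ∑ s, ∑ i, ((if x = a s i then 1 else 0) - (if x = - a s i then 1 else 0))

theorem gpC_anti {n : ℕ} (a : Fin 2 → Fin 3 → ZMod n) (x : ZMod n) : gpC a (-x) = - gpC a x := by
  unfold gpC
  rw [← Finset.sum_neg_distrib]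
  refine Finset.sum_congr rfl fun s _ => ?_
  rw [← Finset.sum_neg_distrib]
  refine Finset.sum_congr rfl fun i _ => ?_
  rw [neg_sub]
  simp only [neg_eq_iff_eq_neg, neg_neg]

theorem gpC_rel {n : ℕ} [NeZero n] (a : Fin 2 → Fin 3 → ZMod n) (hne : ∀ s i, a s i ≠ 0)
    (hv : ∀ l : (ZMod n)ˣ, ∑ s, ∑ i, (((l : ZMod n) * a s i).val : ℤ) = 3 * n)
    (l : (ZMod n)ˣ) : ∑ x, gpC a x * (((l : ZMod n) * x).val : ℤ) = 0 := by
  unfold gpC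
  simp only [Finset.sum_mul]
  rw [Finset.sum_comm]
  have h1 : ∀ s, ∑ x : ZMod n, ∑ i, ((if x = a s i then (1 : ℤ) else 0) -
      (if x = - a s i then 1 else 0)) * (((l : ZMod n) * x).val : ℤ) =
      ∑ i, (2 * (((l : ZMod n) * a s i).val : ℤ) - n) := by
    intro s
    rw [Finset.sum_comm]
    refine Finset.sum_congr rfl fun i _ => ?_
    simp only [sub_mul, ite_mul, one_mul, zero_mul, Finset.sum_sub_distrib,
      Finset.sum_ite_eq', Finset.mem_univ, if_true]
    have hx : (l : ZMod n) * a s i ≠ 0 := by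
      rw [Ne, Units.mul_right_eq_zero]; exact hne s i
    rw [mul_neg, ZMod.neg_val, if_neg hx]
    have := (ZMod.val_lt ((l : ZMod n) * a s i)).le
    push_cast [this]
    ring
  rw [Finset.sum_congr rfl fun s _ => h1 s]
  have := hv l
  simp only [Finset.sum_sub_distrib, ← Finset.mul_sum, Fin.sum_univ_two] at this ⊢
  simp at this ⊢
  linarith

theorem gpC_supp {n : ℕ} (a : Fin 2 → Fin 3 → ZMod n) (x : ZMod n) (h : gpC a x ≠ 0) :
    ∃ s i, x = a s i ∨ x = - a s i := by
  by_contra hc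
  push Not at hc
  apply h
  unfold gpC
  refine Finset.sum_eq_zero fun s _ => Finset.sum_eq_zero fun i _ => ?_
  rw [if_neg (hc s i).1, if_neg (hc s i).2, sub_zero]

/-- The entry `a s i` is active at level `m`. -/
def gpS {n : ℕ} (a : Fin 2 → Fin 3 → ZMod n) (m : ℕ) (s : Fin 2) (i : Fin 3) : Prop :=
  addOrderOf (a s i) = m ∧ gpC a (a s i) ≠ 0

theorem gp_ind_le {n m : ℕ} [NeZero n] [NeZero m] (h : m ∣ n) (P : Prop) (x : ZMod n) :
    ∑ u : (ZMod m)ˣ, (if gpI n m u = x ∧ P then (1 : ℤ) else 0) ≤ if P then 1 else 0 := by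
  by_cases hP : P
  · simp only [hP, and_true, if_true]
    rw [Finset.sum_boole]
    have : (Finset.univ.filter fun u : (ZMod m)ˣ => gpI n m u = x).card ≤ 1 := by
      rw [Finset.card_le_one]
      intro u hu v hv
      simp only [Finset.mem_filter, Finset.mem_univ, true_and] at hu hv
      exact Units.ext (gpI_inj h (hu.trans hv.symm))
    exact_mod_cast this
  · simp [hP]

theorem gpC_norm {n m : ℕ} [NeZero n] [NeZero m] (h : m ∣ n) (a : Fin 2 → Fin 3 → ZMod n) :
    gpN (fun u : (ZMod m)ˣ => gpC a (gpI n m u)) ≤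
      2 * ∑ s, ∑ i, (if gpS a m s i then (1 : ℤ) else 0) := by
  unfold gpN
  have h1 : ∀ u : (ZMod m)ˣ, |gpC a (gpI n m u)| ≤
      ∑ s, ∑ i, ((if gpI n m u = a s i ∧ gpS a m s i then (1 : ℤ) else 0) +
        (if gpI n m u = - a s i ∧ gpS a m s i then 1 else 0)) := by
    intro u
    by_cases h0 : gpC a (gpI n m u) = 0
    · rw [h0, abs_zero]
      refine Finset.sum_nonneg fun s _ => Finset.sum_nonneg fun i _ => ?_
      split_ifs <;> norm_num
    · have ho : addOrderOf (gpI n m (u : ZMod m)) = m := (gpI_order h _).mpr ⟨u, rfl⟩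
      conv_lhs => rw [gpC]
      refine (Finset.abs_sum_le_sum_abs _ _).trans (Finset.sum_le_sum fun s _ => ?_)
      refine (Finset.abs_sum_le_sum_abs _ _).trans (Finset.sum_le_sum fun i _ => ?_)
      have e1 : gpI n m (u : ZMod m) = a s i → gpS a m s i := by
        intro e; unfold gpS; rw [← e]; exact ⟨ho, h0⟩
      have e2 : gpI n m (u : ZMod m) = - a s i → gpS a m s i := by
        intro e
        have e' : a s i = - gpI n m (u : ZMod m) := by rw [e, neg_neg]
        unfold gpS; rw [e', addOrderOf_neg, gpC_anti]; exact ⟨ho, neg_ne_zero.mpr h0⟩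
      by_cases f1 : gpI n m (u : ZMod m) = a s i <;> by_cases f2 : gpI n m (u : ZMod m) = - a s i
      · rw [if_pos f1, if_pos f2, if_pos ⟨f1, e1 f1⟩, if_pos ⟨f2, e2 f2⟩]; norm_num
      · rw [if_pos f1, if_neg f2, if_pos ⟨f1, e1 f1⟩, if_neg (fun h => f2 h.1)]; norm_num
      · rw [if_neg f1, if_pos f2, if_neg (fun h => f1 h.1), if_pos ⟨f2, e2 f2⟩]; norm_num
      · rw [if_neg f1, if_neg f2, if_neg (fun h => f1 h.1), if_neg (fun h => f2 h.1)]; norm_num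
  refine (Finset.sum_le_sum fun u _ => h1 u).trans ?_
  rw [Finset.sum_comm, Finset.mul_sum]
  refine Finset.sum_le_sum fun s _ => ?_
  rw [Finset.sum_comm, Finset.mul_sum]
  refine Finset.sum_le_sum fun i _ => ?_
  rw [Finset.sum_add_distrib, two_mul]
  exact add_le_add (gp_ind_le h _ _) (gp_ind_le h _ _)

/-- Three elements with zero sum, each `±w`, force `w = 0`. -/
theorem gp_sum3 {n : ℕ} (h3 : IsUnit (3 : ZMod n)) (f : Fin 3 → ZMod n) (w : ZMod n)
    (hf : ∑ i, f i = 0) (h : ∀ i, f i = w ∨ f i = -w) : w = 0 := by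
  rw [Fin.sum_univ_three] at hf
  rcases h 0 with h0 | h0 <;> rcases h 1 with h1 | h1 <;> rcases h 2 with h2 | h2 <;>
    rw [h0, h1, h2] at hf <;> ring_nf at hf
  all_goals first
    | exact hf
    | exact neg_eq_zero.mp hf
    | exact (h3.mul_left_eq_zero).mp hf
    | exact neg_eq_zero.mp ((h3.mul_left_eq_zero).mp (by rw [← hf]; ring))

theorem gp_two_of_three (P : Fin 3 → Prop) (h : ¬ ∀ i, P i) :
    ∑ i, (if P i then (1 : ℤ) else 0) ≤ 2 := by
  rw [Fin.sum_univ_three]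
  push Not at h
  obtain ⟨i, hi⟩ := h
  fin_cases i <;> simp only [Fin.zero_eta, Fin.mk_one, Fin.reduceFinMk] at hi <;> rw [if_neg hi] <;>
    split_ifs <;> norm_num

theorem gp_fin3 (k : Fin 3) : ∃ i j : Fin 3, (∀ x, x = i ∨ x = j ∨ x = k) ∧
    ∀ {M : Type} [AddCommMonoid M] (f : Fin 3 → M), ∑ x, f x = f i + f j + f k := by
  fin_cases k
  · exact ⟨1, 2, by decide, fun f => by
      rw [Fin.sum_univ_three]; simp only [Fin.zero_eta]; abel⟩
  · exact ⟨0, 2, by decide, fun f => by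
      rw [Fin.sum_univ_three]; simp only [Fin.mk_one]; abel⟩
  · exact ⟨0, 1, by decide, fun f => by
      rw [Fin.sum_univ_three]; rfl⟩

/-- Values in a line configuration. -/
theorem gp_vals {n e : ℕ} [NeZero n] (he : 5 * e < n) (x y : ZMod n)
    (hx : 5 * x = 5 * (e : ZMod n)) (hy : 5 * y = 5 * (e : ZMod n)) (hxe : x ≠ e) (hye : y ≠ e)
    (hxy : x + y = 2 * (e : ZMod n)) (h0 : 0 < e) :
    x.val + y.val + (-(x + y)).val = 2 * n := by
  have key : ∀ z : ZMod n, 5 * z = 5 * (e : ZMod n) → z ≠ e → e < z.val := by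
    intro z hz hze
    have h1 : ((5 * z.val : ℕ) : ZMod n) = ((5 * e : ℕ) : ZMod n) := by
      push_cast; rw [ZMod.natCast_zmod_val]; exact hz
    rw [ZMod.natCast_eq_natCast_iff] at h1
    by_contra hlt
    have h2 : 5 * z.val = 5 * e := Nat.ModEq.eq_of_lt_of_lt h1 (by omega) he
    apply hze
    rw [← ZMod.natCast_zmod_val z]
    congr 1
    omega
  have kx := key x hx hxe
  have ky := key y hy hye
  have lx := ZMod.val_lt x
  have ly := ZMod.val_lt y
  have hv : (x + y).val = 2 * e := by
    rw [hxy]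
    have : (2 * (e : ZMod n)) = ((2 * e : ℕ) : ZMod n) := by push_cast; rfl
    rw [this, ZMod.val_natCast, Nat.mod_eq_of_lt (by omega)]
  have hnz : x + y ≠ 0 := by
    intro h; rw [h, ZMod.val_zero] at hv; omega
  have hadd := ZMod.val_add x y
  rw [hv] at hadd
  rw [ZMod.neg_val, if_neg hnz, hv]
  have : (x.val + y.val) = n + 2 * e := by
    rcases lt_or_ge (x.val + y.val) n with h | h
    · rw [Nat.mod_eq_of_lt h] at hadd; omega
    · rw [Nat.mod_eq_sub_mod h, Nat.mod_eq_of_lt (by omega)] at hadd; omega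
  omega

end GPmain

section GPline

theorem gp_coset_count {m : ℕ} [NeZero m] (H : Subgroup (ZMod m)ˣ) (a : (ZMod m)ˣ) :
    ∑ u : (ZMod m)ˣ, (if u * a⁻¹ ∈ H then (1 : ℤ) else 0) = Nat.card H := by
  rw [← Equiv.sum_comp (Equiv.mulRight a)]
  simp only [Equiv.coe_mulRight, mul_inv_cancel_right]
  rw [Finset.sum_boole, Nat.card_eq_fintype_card, Fintype.card_subtype]

theorem gp_pick {n m : ℕ} [NeZero n] [NeZero m] (h : m ∣ n) (Q : (ZMod m)ˣ → Prop) (x : ZMod n) :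
    ∑ u : (ZMod m)ˣ, (if Q u then (if gpI n m u = x then (1 : ℤ) else 0) else 0) =
      if ∃ u : (ZMod m)ˣ, x = gpI n m u ∧ Q u then 1 else 0 := by
  split_ifs with hx
  · obtain ⟨u0, hu0, hq⟩ := hx
    rw [Finset.sum_eq_single u0]
    · rw [if_pos hq, if_pos hu0.symm]
    · intro b _ hb
      have : gpI n m (b : ZMod m) ≠ x := by
        intro e
        exact hb (Units.ext (gpI_inj h (e.trans hu0)))
      rw [if_neg this]; simp
    · simp
  · refine Finset.sum_eq_zero fun u _ => ?_
    by_cases hq : Q u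
    · rw [if_pos hq, if_neg]
      intro e
      exact hx ⟨u, e.symm, hq⟩
    · rw [if_neg hq]

/-- Structure of the two triples in the line case. -/
theorem gp_line_struct {n m : ℕ} [NeZero n] [NeZero m] (h : m ∣ n)
    (h2 : IsUnit (2 : ZMod n)) (h3 : IsUnit (3 : ZMod n))
    (a : Fin 2 → Fin 3 → ZMod n) (hsum : ∀ s, ∑ i, a s i = 0)
    (h5 : 5 ∣ m) (h55 : ¬ 5 ∣ m / 5) (hm5 : m ≠ 5)
    (a0 : (ZMod m)ˣ) (ε : ℤ) (hε : ε = 1 ∨ ε = -1)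
    (hc : ∀ u : (ZMod m)ˣ, gpC a (gpI n m u) = (if u * a0⁻¹ ∈ gpH m 5 then ε else 0) -
        (if u * (-1 * a0)⁻¹ ∈ gpH m 5 then ε else 0)) :
    ∃ W : ZMod n, W ≠ 0 ∧ ∀ s, ∃ i j k : Fin 3, (∀ x, x = i ∨ x = j ∨ x = k) ∧
      (∀ {M : Type} [AddCommMonoid M] (f : Fin 3 → M), ∑ x, f x = f i + f j + f k) ∧
      5 * a s i = W ∧ 5 * a s j = W ∧ addOrderOf (a s i) = m ∧ addOrderOf (a s j) = m ∧
      (addOrderOf (a s k) = m → gpC a (a s k) = 0) := by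
  have hmpos := NeZero.pos m
  have hm5' : 5 < m := lt_of_le_of_ne (Nat.le_of_dvd hmpos h5) (Ne.symm hm5)
  obtain ⟨w, hw⟩ : ∃ w, w = ((5 : ℕ) : ZMod n) * gpI n m a0 := ⟨_, rfl⟩
  have hw0 : w ≠ 0 := by
    rw [hw, gpI_smul h]
    intro e
    have e0 : gpI n m (0 : ZMod m) = 0 := by unfold gpI; simp
    rw [← e0] at e
    exact gp_natCast_mul_ne (by norm_num) hm5' a0 (gpI_inj h e)
  let Q : (ZMod m)ˣ → Prop := fun u => u * a0⁻¹ ∈ gpH m 5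
  let PP : ZMod n → Prop := fun x => ∃ u : (ZMod m)ˣ, x = gpI n m u ∧ Q u
  have hPP5 : ∀ x, PP x → 5 * x = w := by
    rintro x ⟨u, rfl, hu⟩
    have h1 := gpKer_smul (Nat.div_dvd_of_dvd h5) u a0 hu
    rw [Nat.div_div_self h5 hmpos.ne'] at h1
    have h2' := gpI_smul h 5 (u : ZMod m)
    rw [h1, ← gpI_smul h, ← hw] at h2'
    exact_mod_cast h2'
  have hPPo : ∀ x, PP x → addOrderOf x = m := by
    rintro x ⟨u, rfl, hu⟩
    exact (gpI_order h _).mpr ⟨u, rfl⟩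
  have hex : ∀ x, PP x → ¬ PP (-x) := by
    intro x hx hx'
    have e1 := hPP5 _ hx
    have e2 := hPP5 _ hx'
    apply hw0
    have : (2 : ZMod n) * w = 0 := by
      calc (2 : ZMod n) * w = w + w := by ring
        _ = 5 * x + 5 * -x := by rw [e1, e2]
        _ = 0 := by ring
    exact (h2.mul_right_eq_zero).mp this
  have hPPι : ∀ u : (ZMod m)ˣ, PP (gpI n m u) ↔ Q u := by
    intro u
    constructor
    · rintro ⟨v, hv, hq⟩
      have : u = v := Units.ext (gpI_inj h hv)
      rw [this]; exact hq
    · intro hq; exact ⟨u, rfl, hq⟩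
  have hPPι' : ∀ u : (ZMod m)ˣ, PP (- gpI n m u) ↔ u * (-1 * a0)⁻¹ ∈ gpH m 5 := by
    intro u
    have e : - gpI n m (u : ZMod m) = gpI n m ((-1 * u : (ZMod m)ˣ) : ZMod m) := by
      rw [← gpI_neg h]; congr 1; push_cast; ring
    rw [e, hPPι]
    have e2 : u * (-1 * a0)⁻¹ = (-1 * u) * a0⁻¹ := by
      rw [mul_inv]; simp
    rw [e2]
  let t : Fin 2 → Fin 3 → ℤ := fun s i => (if PP (a s i) then 1 else 0) - (if PP (- a s i) then 1 else 0)
  have hcard : (Nat.card (gpH m 5) : ℤ) = 4 := by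
    rw [gpH_card (by norm_num) h5, if_neg h55]; norm_num
  have hA : ∑ u : (ZMod m)ˣ, (if Q u then gpC a (gpI n m u) else 0) = 4 * ε := by
    have : ∀ u : (ZMod m)ˣ, (if Q u then gpC a (gpI n m u) else 0) =
        ε * (if u * a0⁻¹ ∈ gpH m 5 then (1 : ℤ) else 0) := by
      intro u
      by_cases hq : Q u
      · have hn : ¬ u * (-1 * a0)⁻¹ ∈ gpH m 5 := by
          rw [← hPPι']; exact hex _ ((hPPι u).mpr hq)
        have hq' : u * a0⁻¹ ∈ gpH m 5 := hq
        rw [if_pos hq, hc, if_neg hn, if_pos hq', if_pos hq']; ring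
      · have hq' : ¬ u * a0⁻¹ ∈ gpH m 5 := hq
        rw [if_neg hq, if_neg hq']; ring
    rw [Finset.sum_congr rfl fun u _ => this u, ← Finset.mul_sum, gp_coset_count, hcard]; ring
  have hB : ∑ u : (ZMod m)ˣ, (if Q u then gpC a (gpI n m u) else 0) = ∑ s, ∑ i, t s i := by
    have e1 : ∀ u : (ZMod m)ˣ, (if Q u then gpC a (gpI n m u) else 0) =
        ∑ s, ∑ i, ((if Q u then (if gpI n m u = a s i then (1 : ℤ) else 0) else 0) -
          (if Q u then (if gpI n m u = - a s i then (1 : ℤ) else 0) else 0)) := by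
      intro u
      by_cases hq : Q u
      · simp only [if_pos hq]; rfl
      · simp only [if_neg hq]; simp
    rw [Finset.sum_congr rfl fun u _ => e1 u, Finset.sum_comm]
    refine Finset.sum_congr rfl fun s _ => ?_
    rw [Finset.sum_comm]
    refine Finset.sum_congr rfl fun i _ => ?_
    rw [Finset.sum_sub_distrib, gp_pick h, gp_pick h]
  have hT : ∑ s, ∑ i, t s i = 4 * ε := hB.symm.trans hA
  have ht1 : ∀ s i, t s i ≠ 0 → 5 * a s i = w ∨ 5 * a s i = -w := by
    intro s i ht
    by_cases p : PP (a s i)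
    · left; exact hPP5 _ p
    · by_cases p' : PP (- a s i)
      · right
        have := hPP5 _ p'
        rw [← this]; ring
      · exfalso; apply ht
        simp only [t, if_neg p, if_neg p', sub_zero]
  have htle : ∀ s i, ε * t s i ≤ 1 := by
    intro s i
    simp only [t]
    rcases hε with rfl | rfl <;> split_ifs <;> norm_num
  have hk : ∀ s, ∃ k, t s k = 0 := by
    intro s
    by_contra hcon
    push Not at hcon
    apply hw0
    refine gp_sum3 h3 (fun i => 5 * a s i) w ?_ fun i => ht1 s i (hcon i)
    rw [← Finset.mul_sum, hsum, mul_zero]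
  have ht2 : ∀ s i, ε * t s i = 1 → 5 * a s i = (ε : ZMod n) * w ∧ addOrderOf (a s i) = m := by
    intro s i ht
    by_cases p : PP (a s i)
    · have : t s i = 1 := by simp only [t, if_pos p, if_neg (hex _ p), sub_zero]
      rw [this, mul_one] at ht
      refine ⟨?_, hPPo _ p⟩
      rw [hPP5 _ p, ht]; simp
    · by_cases p' : PP (- a s i)
      · have : t s i = -1 := by simp only [t, if_neg p, if_pos p', zero_sub]
        rw [this] at ht
        have hε' : ε = -1 := by linarith
        refine ⟨?_, by rw [← addOrderOf_neg]; exact hPPo _ p'⟩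
        rw [← hPP5 _ p', hε']; push_cast; ring
      · exfalso
        have : t s i = 0 := by simp only [t, if_neg p, if_neg p', sub_zero]
        rw [this] at ht; norm_num at ht
  choose k hk using hk
  choose i j hcov hs3 using fun s => gp_fin3 (k s)
  have hε2 : ε * ε = 1 := by rcases hε with rfl | rfl <;> norm_num
  have htot : ε * (∑ s, ∑ i, t s i) = 4 := by rw [hT]; linarith
  rw [Fin.sum_univ_two, hs3 0, hs3 1, hk 0, hk 1] at htot
  have b1 := htle 0 (i 0)
  have b2 := htle 0 (j 0)
  have b3 := htle 1 (i 1)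
  have b4 := htle 1 (j 1)
  have hij : ∀ s, ε * t s (i s) = 1 ∧ ε * t s (j s) = 1 := by
    intro s
    have : ε * t 0 (i 0) + ε * t 0 (j 0) + ε * t 1 (i 1) + ε * t 1 (j 1) = 4 := by
      rw [← htot]; ring
    fin_cases s
    · exact ⟨by simp only [Fin.zero_eta]; linarith, by simp only [Fin.zero_eta]; linarith⟩
    · exact ⟨by simp only [Fin.mk_one]; linarith, by simp only [Fin.mk_one]; linarith⟩
  refine ⟨(ε : ZMod n) * w, ?_, fun s => ⟨i s, j s, k s, hcov s, hs3 s,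
    (ht2 _ _ (hij s).1).1, (ht2 _ _ (hij s).2).1, (ht2 _ _ (hij s).1).2, (ht2 _ _ (hij s).2).2, ?_⟩⟩
  · rcases hε with rfl | rfl
    · simpa using hw0
    · simpa using hw0
  · intro ho
    obtain ⟨u, hu⟩ := (gpI_order h _).mp ho
    have hks := hk s
    rw [hu, hc]
    simp only [t] at hks
    rw [hu] at hks
    have r1 : (if PP (gpI n m u) then (1 : ℤ) else 0) = if u * a0⁻¹ ∈ gpH m 5 then 1 else 0 := by
      simp only [hPPι]; rfl
    have r2 : (if PP (- gpI n m u) then (1 : ℤ) else 0) = if u * (-1 * a0)⁻¹ ∈ gpH m 5 then 1 else 0 := by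
      simp only [hPPι']
    rw [r1, r2] at hks
    have : ε * ((if u * a0⁻¹ ∈ gpH m 5 then (1 : ℤ) else 0) -
      (if u * (-1 * a0)⁻¹ ∈ gpH m 5 then 1 else 0)) = 0 := by rw [hks, mul_zero]
    refine Eq.trans ?_ this
    split_ifs <;> ring

end GPline

section GPend

theorem gp_line_false {n m : ℕ} [NeZero n] [NeZero m] (h : m ∣ n)
    (h2 : IsUnit (2 : ZMod n)) (h3 : IsUnit (3 : ZMod n))
    (hp : ∀ q, q.Prime → q ∣ m → 5 ≤ q)
    (a : Fin 2 → Fin 3 → ZMod n) (hsum : ∀ s, ∑ i, a s i = 0)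
    (hv : ∀ l : (ZMod n)ˣ, ∑ s, ∑ i, (((l : ZMod n) * a s i).val : ℤ) = 3 * n)
    (h5 : 5 ∣ m) (h55 : ¬ 5 ∣ m / 5) (hm5 : m ≠ 5)
    (a0 : (ZMod m)ˣ) (ε : ℤ) (hε : ε = 1 ∨ ε = -1)
    (hc : ∀ u : (ZMod m)ˣ, gpC a (gpI n m u) = (if u * a0⁻¹ ∈ gpH m 5 then ε else 0) -
        (if u * (-1 * a0)⁻¹ ∈ gpH m 5 then ε else 0)) : False := by
  obtain ⟨W, hW0, hst⟩ := gp_line_struct h h2 h3 a hsum h5 h55 hm5 a0 ε hε hc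
  choose i j k hcov hs3 h5i h5j hoi hoj hok using hst
  have hmpos := NeZero.pos m
  have hnpos := NeZero.pos n
  have h4 : IsUnit (4 : ZMod n) := by
    have := h2.mul h2
    norm_num at this; exact this
  have hsum' : ∀ s, a s (i s) + a s (j s) + a s (k s) = 0 := fun s => by
    rw [← hs3 s (a s)]; exact hsum s
  have h5k : ∀ s, 5 * a s (k s) = - (2 * W) := by
    intro s
    have : a s (k s) = - (a s (i s) + a s (j s)) := by
      rw [eq_neg_iff_add_eq_zero, ← hsum' s]; ring
    rw [this]
    calc 5 * -(a s (i s) + a s (j s)) = -(5 * a s (i s) + 5 * a s (j s)) := by ring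
      _ = -(2 * W) := by rw [h5i, h5j]; ring
  have hokm : ∀ s, addOrderOf (a s (k s)) ≠ m := by
    intro s ho
    have hz := hok s ho
    have hex : ∃ s' i', a s (k s) = - a s' i' := by
      by_contra hcon
      push Not at hcon
      have : (1 : ℤ) ≤ gpC a (a s (k s)) := by
        unfold gpC
        have hnn : ∀ s' i', (0 : ℤ) ≤ (if a s (k s) = a s' i' then 1 else 0) -
            (if a s (k s) = - a s' i' then 1 else 0) := by
          intro s' i'
          rw [if_neg (hcon s' i')]
          split_ifs <;> norm_num
        refine le_trans ?_ (Finset.single_le_sum (fun s' _ => Finset.sum_nonneg fun i' _ => hnn s' i')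
          (Finset.mem_univ s))
        refine le_trans ?_ (Finset.single_le_sum (fun i' _ => hnn s i') (Finset.mem_univ (k s)))
        rw [if_neg (hcon _ _), if_pos rfl]; norm_num
      omega
    obtain ⟨s', i', he⟩ := hex
    have e5 : 5 * a s' i' = 2 * W := by
      have := h5k s
      rw [he] at this
      calc 5 * a s' i' = -(5 * - a s' i') := by ring
        _ = 2 * W := by rw [this]; ring
    have hWW : 2 * W = W ∨ 2 * W = - (2 * W) := by
      rcases hcov s' i' with e | e | e
      · left; rw [← e5, e, h5i]
      · left; rw [← e5, e, h5j]
      · right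
        have := h5k s'
        rw [← e, e5] at this
        exact this
    rcases hWW with e | e
    · apply hW0
      calc W = 2 * W - W := by ring
        _ = 0 := by rw [e]; ring
    · apply hW0
      refine (h4.mul_right_eq_zero).mp ?_
      calc 4 * W = 2 * W + 2 * W := by ring
        _ = -(2 * W) + 2 * W := by rw [← e]
        _ = 0 := by ring
  obtain ⟨M, hM⟩ : ∃ M, M = m / 5 := ⟨_, rfl⟩
  have hmM : m = 5 * M := by rw [hM]; exact (Nat.mul_div_cancel' h5).symm
  rw [← hM] at h55
  have hM0 : 0 < M := by omega
  have hMn : M ∣ n := (Dvd.intro_left 5 hmM.symm).trans h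
  have : NeZero M := ⟨hM0.ne'⟩
  have hMm : M ∣ m := Dvd.intro_left 5 hmM.symm
  have hM2 : Nat.Coprime 2 M := by
    refine (Nat.Prime.coprime_iff_not_dvd Nat.prime_two).mpr fun hd => ?_
    have := hp 2 Nat.prime_two (hd.trans hMm)
    omega
  have hM6 : 6 ≤ M := by
    have h1 : M ≠ 1 := by rintro rfl; omega
    have := hp _ (Nat.minFac_prime h1) ((Nat.minFac_dvd M).trans hMm)
    have h3 := Nat.minFac_le hM0
    have : M ≠ 5 := by rintro rfl; exact h55 dvd_rfl
    omega
  have hM5 : Nat.Coprime 5 M := (Nat.Prime.coprime_iff_not_dvd (by norm_num)).mpr h55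
  have hoW : addOrderOf W = M := by
    have := addOrderOf_nsmul (n := 5) (a 0 (i 0))
    rw [nsmul_eq_mul] at this
    push_cast at this
    rw [h5i, hoi, hmM, Nat.gcd_eq_right (Dvd.intro _ rfl), Nat.mul_div_cancel_left _ (by norm_num)] at this
    exact this
  have ho2W : addOrderOf (-(2 * W)) = M := by
    have := addOrderOf_nsmul (n := 2) W
    rw [nsmul_eq_mul, hoW, Nat.gcd_comm, hM2, Nat.div_one] at this
    rw [addOrderOf_neg]
    exact_mod_cast this
  have hoK : ∀ s, addOrderOf (a s (k s)) = M := by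
    intro s
    have := addOrderOf_nsmul (n := 5) (a s (k s))
    rw [nsmul_eq_mul] at this
    push_cast at this
    rw [h5k, ho2W] at this
    rcases (Nat.dvd_prime (by norm_num : Nat.Prime 5)).mp (Nat.gcd_dvd_right (addOrderOf (a s (k s))) 5)
      with e | e
    · rw [e, Nat.div_one] at this; exact this.symm
    · exfalso
      apply hokm s
      have hd : 5 ∣ addOrderOf (a s (k s)) := by
        rw [← e]; exact Nat.gcd_dvd_left _ _
      rw [e] at this
      omega
  have hsame : a 0 (k 0) = a 1 (k 1) := by
    rw [← sub_eq_zero]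
    have d1 : addOrderOf (a 0 (k 0) - a 1 (k 1)) ∣ 5 := by
      rw [addOrderOf_dvd_iff_nsmul_eq_zero, nsmul_eq_mul]
      push_cast
      rw [mul_sub, h5k, h5k, sub_self]
    have d2 : addOrderOf (a 0 (k 0) - a 1 (k 1)) ∣ M := by
      rw [addOrderOf_dvd_iff_nsmul_eq_zero, nsmul_sub]
      have e0 := addOrderOf_nsmul_eq_zero (a 0 (k 0))
      have e1 := addOrderOf_nsmul_eq_zero (a 1 (k 1))
      rw [hoK] at e0 e1
      rw [e0, e1, sub_zero]
    have := Nat.dvd_gcd d1 d2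
    rw [hM5, Nat.dvd_one, AddMonoid.addOrderOf_eq_one_iff] at this
    exact this
  obtain ⟨v, hvv⟩ := (gpI_order hMn (- a 0 (k 0))).mp (by rw [addOrderOf_neg]; exact hoK 0)
  obtain ⟨l, hl⟩ := ZMod.unitsMap_surjective hMn (ZMod.unitOfCoprime 2 hM2 * v⁻¹)
  obtain ⟨e, he⟩ : ∃ e, e = n / M := ⟨_, rfl⟩
  have hne : n = M * e := by rw [he]; exact (Nat.mul_div_cancel' hMn).symm
  have hlk : ∀ s, (l : ZMod n) * - a s (k s) = 2 * (e : ZMod n) := by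
    have h0 : (l : ZMod n) * - a 0 (k 0) = 2 * (e : ZMod n) := by
      rw [hvv, gpI_mul hMn]
      have : ZMod.castHom hMn (ZMod M) (l : ZMod n) = ((ZMod.unitsMap hMn l : (ZMod M)ˣ) : ZMod M) := rfl
      rw [this, hl]
      rw [← Units.val_mul, inv_mul_cancel_right, ZMod.coe_unitOfCoprime, gpI_natCast hMn, ← he]
      push_cast; ring
    intro s
    fin_cases s
    · exact h0
    · simp only [Fin.mk_one]; rw [← hsame]; exact h0
  have he0 : 0 < e := by
    rcases Nat.eq_zero_or_pos e with h | h
    · rw [h] at hne; omega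
    · exact h
  have he5 : 5 * e < n := by rw [hne]; nlinarith
  have h5e : 5 * (e : ZMod n) = l * W := by
    have h1 : 2 * (5 * (e : ZMod n)) = 2 * (l * W) := by
      calc 2 * (5 * (e : ZMod n)) = 5 * (2 * (e : ZMod n)) := by ring
        _ = 5 * ((l : ZMod n) * - a 0 (k 0)) := by rw [hlk]
        _ = - (l * (5 * a 0 (k 0))) := by ring
        _ = 2 * (l * W) := by rw [h5k]; ring
    exact h2.mul_left_cancel h1
  have hne' : ∀ x : ZMod n, addOrderOf x = m → (l : ZMod n) * x ≠ e := by
    intro x hx hle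
    have h1 : (l : ZMod n) * ((M : ZMod n) * x) = 0 := by
      calc (l : ZMod n) * ((M : ZMod n) * x) = M * (l * x) := by ring
        _ = ((M * e : ℕ) : ZMod n) := by rw [hle]; push_cast; rfl
        _ = 0 := by rw [← hne, ZMod.natCast_self]
    rw [Units.mul_right_eq_zero, ← nsmul_eq_mul, ← addOrderOf_dvd_iff_nsmul_eq_zero, hx] at h1
    have := Nat.le_of_dvd hM0 h1
    omega
  have hval : ∀ s, ∑ i, (((l : ZMod n) * a s i).val : ℤ) = 2 * n := by
    intro s
    rw [hs3 s]
    have hxy : (l : ZMod n) * a s (i s) + l * a s (j s) = - (l * a s (k s)) := by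
      rw [eq_neg_iff_add_eq_zero, ← mul_add, ← mul_add, hsum', mul_zero]
    have := gp_vals he5 ((l : ZMod n) * a s (i s)) (l * a s (j s))
      (by rw [h5e, ← h5i s]; ring) (by rw [h5e, ← h5j s]; ring) (hne' _ (hoi s)) (hne' _ (hoj s))
      (by rw [hxy, ← mul_neg, hlk]) he0
    rw [hxy, neg_neg] at this
    exact_mod_cast this
  have := hv l
  rw [Finset.sum_congr rfl fun s _ => hval s] at this
  simp at this
  omega

theorem gp_main {n : ℕ} [NeZero n] (h2 : IsUnit (2 : ZMod n)) (h3 : IsUnit (3 : ZMod n))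
    (hp : ∀ q, q.Prime → q ∣ n → 5 ≤ q)
    (a : Fin 2 → Fin 3 → ZMod n) (hsum : ∀ s, ∑ i, a s i = 0) (hne : ∀ s i, a s i ≠ 0)
    (hv : ∀ l : (ZMod n)ˣ, ∑ s, ∑ i, (((l : ZMod n) * a s i).val : ℤ) = 3 * n) :
    ∀ x, gpC a x = 0 := by
  by_contra hcon
  push Not at hcon
  obtain ⟨x0, hx0⟩ := hcon
  obtain ⟨x, hx, hxmax⟩ := Finset.exists_max_image (Finset.univ.filter fun x => gpC a x ≠ 0)
    addOrderOf ⟨x0, by simpa using hx0⟩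
  simp only [Finset.mem_filter, Finset.mem_univ, true_and] at hx hxmax
  obtain ⟨m, hm⟩ : ∃ m, m = addOrderOf x := ⟨_, rfl⟩
  have hmn : m ∣ n := by
    rw [hm, addOrderOf_dvd_iff_nsmul_eq_zero]; simp
  have hm0 : 0 < m := Nat.pos_of_dvd_of_pos hmn (NeZero.pos n)
  have : NeZero m := ⟨hm0.ne'⟩
  have hpm : ∀ q, q.Prime → q ∣ m → 5 ≤ q := fun q hq hqm => hp q hq (hqm.trans hmn)
  have hanti := gpC_anti a
  have hrel := gpC_rel a hne hv
  have hantim : ∀ u : (ZMod m)ˣ, gpC a (gpI n m ((-1 * u : (ZMod m)ˣ) : ZMod m)) =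
      - gpC a (gpI n m (u : ZMod m)) := by
    intro u
    rw [← hanti, ← gpI_neg hmn]
    congr 2
    push_cast; ring
  have hkill : ∀ L : List ℕ, (∀ q, q.Prime → q ∣ m → q ∈ L) →
      gpKilled (gpH m) L (fun u : (ZMod m)ˣ => gpC a (gpI n m u)) := by
    intro L hL
    refine gp_killed hmn _ hanti hrel ?_ L hL
    intro b hb hd
    have h1 := hxmax b hb
    rw [← hm] at h1
    exact le_antisymm h1 (Nat.le_of_dvd (addOrderOf_pos b) hd)
  have hnem : ∃ u : (ZMod m)ˣ, gpC a (gpI n m u) ≠ 0 := by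
    obtain ⟨u, hu⟩ := (gpI_order hmn x).mp hm.symm
    exact ⟨u, by rw [← hu]; exact hx⟩
  have hbd := gpC_norm hmn a
  have hS3 : ∀ s, ∑ i, (if gpS a m s i then (1 : ℤ) else 0) ≤ 3 := by
    intro s
    rw [Fin.sum_univ_three]
    split_ifs <;> norm_num
  have hN12 : gpN (fun u : (ZMod m)ˣ => gpC a (gpI n m u)) ≤ 12 := by
    rw [Fin.sum_univ_two] at hbd
    have := hS3 0
    have := hS3 1
    linarith
  rcases gp_tri hpm (fun u : (ZMod m)ˣ => gpC a (gpI n m u)) hantim hkill hnem hN12 with hal | ⟨h35, h12⟩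
  · obtain ⟨N, a0, _, hN0, hall, h8⟩ := hal
    have hw0 : gpI n m ((N : ZMod m) * a0) ≠ 0 := by
      intro e
      have e0 : gpI n m (0 : ZMod m) = 0 := by unfold gpI; simp
      rw [← e0] at e
      exact hN0 (gpI_inj hmn e)
    have hS2 : ∀ s, ∑ i, (if gpS a m s i then (1 : ℤ) else 0) ≤ 2 := by
      intro s
      apply gp_two_of_three
      intro hall3
      apply hw0
      refine gp_sum3 h3 (fun i => (N : ZMod n) * a s i) _ ?_ fun i => ?_
      · rw [← Finset.mul_sum, hsum, mul_zero]
      · obtain ⟨ho, hci⟩ := hall3 i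
        obtain ⟨u, hu⟩ := (gpI_order hmn _).mp ho
        rw [hu] at hci
        rw [hu, gpI_smul hmn, ← gpI_neg hmn]
        rcases hall u hci with e | e
        · left; rw [e]
        · right; rw [e]
    have hN8 : gpN (fun u : (ZMod m)ˣ => gpC a (gpI n m u)) ≤ 8 := by
      rw [Fin.sum_univ_two] at hbd
      have := hS2 0
      have := hS2 1
      linarith
    obtain ⟨h5, h55, hm5, ε, hε, hc⟩ := h8 hN8
    exact gp_line_false hmn h2 h3 hpm a hsum hv h5 h55 hm5 a0 ε hε hc
  · have hall : ∀ s i, gpS a m s i := by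
      by_contra hcon
      push Not at hcon
      obtain ⟨s, i, hsi⟩ := hcon
      have := gp_two_of_three (fun i => gpS a m s i) (fun h => hsi (h i))
      rw [Fin.sum_univ_two] at hbd
      have := hS3 0
      have := hS3 1
      fin_cases s
      · simp only [Fin.zero_eta] at *; linarith
      · simp only [Fin.mk_one] at *; linarith
    have hsupp : ∀ y, gpC a y ≠ 0 → ∃ u : (ZMod m)ˣ, y = gpI n m u := by
      intro y hy
      rw [← gpI_order hmn]
      obtain ⟨s, i, e | e⟩ := gpC_supp a y hy
      · rw [e]; exact (hall s i).1
      · rw [e, addOrderOf_neg]; exact (hall s i).1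
    obtain ⟨u0, hu0⟩ := hnem
    clear hS3 hN12 h12 hbd
    subst h35
    apply hu0
    refine gp35 (fun u : (ZMod 35)ˣ => gpC a (gpI n 35 u)) hantim ?_ u0
    intro l
    obtain ⟨l', hl'⟩ := ZMod.unitsMap_surjective hmn l
    have h1 := hrel l'
    have h2 : ∑ u : (ZMod 35)ˣ, gpC a (gpI n 35 u) * (((l' : ZMod n) * gpI n 35 u).val : ℤ) =
        ∑ x, gpC a x * (((l' : ZMod n) * x).val : ℤ) := by
      refine Finset.sum_of_injOn (fun u : (ZMod 35)ˣ => gpI n 35 (u : ZMod 35)) ?_ ?_ ?_ ?_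
      · intro u _ v _ huv
        exact Units.ext (gpI_inj hmn huv)
      · intro u _; simp
      · intro y _ hy
        by_contra h0
        obtain ⟨u, hu⟩ := hsupp y (left_ne_zero_of_mul h0)
        exact hy ⟨u, by simp, hu.symm⟩
      · intro u _; rfl
    rw [h1] at h2
    have h3 : ∀ u : (ZMod 35)ˣ, gpC a (gpI n 35 u) * (((l' : ZMod n) * gpI n 35 u).val : ℤ) =
        ((n / 35 : ℕ) : ℤ) * (gpC a (gpI n 35 u) * (((l * u : (ZMod 35)ˣ) : ZMod 35).val : ℤ)) := by
      intro u
      have e : ZMod.castHom hmn (ZMod 35) (l' : ZMod n) = ((ZMod.unitsMap hmn l' : (ZMod 35)ˣ) : ZMod 35) := rfl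
      rw [gpI_mul hmn, e, hl', gpI_val hmn, Units.val_mul]
      push_cast; ring
    rw [Finset.sum_congr rfl fun u _ => h3 u, ← Finset.mul_sum] at h2
    rcases mul_eq_zero.mp h2 with h | h
    · exfalso
      have : 0 < n / 35 := Nat.div_pos (Nat.le_of_dvd (NeZero.pos n) hmn) (by norm_num)
      have h' : n / 35 = 0 := by exact_mod_cast h
      omega
    · exact h

end GPend

section GPfinal

theorem gp_int {n : ℕ} (hn : 0 < n) (ℓ : ℤ) (hl : Int.gcd ℓ (3 * n) = 1) (x y z : ℤ)
    (hz : 0 < z) (hzn : z < n) (hs : x + y + z = n) :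
    ((ℓ * x) % (n : ℤ) + (ℓ * y) % (n : ℤ) < (n : ℤ) →
      (ℓ * x) % (n : ℤ) + (ℓ * y) % (n : ℤ) + (ℓ * z) % (n : ℤ) = n) ∧
    (¬ (ℓ * x) % (n : ℤ) + (ℓ * y) % (n : ℤ) < (n : ℤ) →
      (ℓ * x) % (n : ℤ) + (ℓ * y) % (n : ℤ) + (ℓ * z) % (n : ℤ) = 2 * n) := by
  have hn' : (0 : ℤ) < n := by exact_mod_cast hn
  have x0 := Int.emod_nonneg (ℓ * x) hn'.ne'
  have x1 := Int.emod_lt_of_pos (ℓ * x) hn'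
  have y0 := Int.emod_nonneg (ℓ * y) hn'.ne'
  have y1 := Int.emod_lt_of_pos (ℓ * y) hn'
  have z0 := Int.emod_nonneg (ℓ * z) hn'.ne'
  have z1 := Int.emod_lt_of_pos (ℓ * z) hn'
  have hco : IsCoprime (n : ℤ) ℓ := by
    have : IsCoprime ℓ (3 * n : ℤ) := Int.isCoprime_iff_gcd_eq_one.mpr hl
    exact (IsCoprime.of_mul_right_right this).symm
  have zne : (ℓ * z) % (n : ℤ) ≠ 0 := by
    intro h
    have := Int.le_of_dvd hz (hco.dvd_of_dvd_mul_left (Int.dvd_of_emod_eq_zero h))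
    omega
  have hd : (n : ℤ) ∣ (ℓ * x) % (n : ℤ) + (ℓ * y) % (n : ℤ) + (ℓ * z) % (n : ℤ) := by
    have e : (ℓ * x) % (n : ℤ) + (ℓ * y) % (n : ℤ) + (ℓ * z) % (n : ℤ) =
        n * (ℓ - (ℓ * x) / n - (ℓ * y) / n - (ℓ * z) / n) := by
      have h1 := Int.mul_ediv_add_emod (ℓ * x) n
      have h2 := Int.mul_ediv_add_emod (ℓ * y) n
      have h3 := Int.mul_ediv_add_emod (ℓ * z) n
      have h4 : ℓ * x + ℓ * y + ℓ * z = ℓ * n := by rw [← hs]; ring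
      linear_combination h1 + h2 + h3 + h4
    exact ⟨_, e⟩
  obtain ⟨k, hk⟩ := hd
  rw [hk]
  constructor
  · intro h
    have h1 : 0 < k := by
      by_contra hc
      have : (n : ℤ) * k ≤ 0 := mul_nonpos_of_nonneg_of_nonpos hn'.le (by omega)
      omega
    have h2 : k < 2 := by
      by_contra hc
      have : (n : ℤ) * 2 ≤ n * k := mul_le_mul_of_nonneg_left (by omega) hn'.le
      omega
    have : k = 1 := by omega
    rw [this, mul_one]
  · intro h
    have h1 : 1 < k := by
      by_contra hc
      have : (n : ℤ) * k ≤ n * 1 := mul_le_mul_of_nonneg_left (by omega) hn'.le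
      omega
    have h2 : k < 3 := by
      by_contra hc
      have : (n : ℤ) * 3 ≤ n * k := mul_le_mul_of_nonneg_left (by omega) hn'.le
      omega
    have : k = 2 := by omega
    rw [this, mul_comm]

theorem gp_iff {n : ℕ} (hn : 0 < n) (ℓ : ℤ) (hl : Int.gcd ℓ (3 * n) = 1) (x y z : ℤ)
    (hz : 0 < z) (hzn : z < n) (hs : x + y + z = n) :
    (ℓ * x) % (n : ℤ) + (ℓ * y) % (n : ℤ) < (n : ℤ) ↔
      (ℓ * x) % (n : ℤ) + (ℓ * y) % (n : ℤ) + (ℓ * z) % (n : ℤ) = n := by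
  obtain ⟨h1, h2⟩ := gp_int hn ℓ hl x y z hz hzn hs
  refine ⟨h1, fun h => ?_⟩
  by_contra hc
  have := h2 hc
  have hn' : (0 : ℤ) < n := by exact_mod_cast hn
  omega

theorem gp_cast_eq {n : ℕ} (x y : ℤ) (hx : 0 < x) (hxn : x < n) (hy : 0 < y) (hyn : y < n) :
    (x : ZMod n) = (y : ZMod n) ↔ x = y := by
  rw [ZMod.intCast_eq_intCast_iff]
  constructor
  · intro h
    have := h.eq
    rwa [Int.emod_eq_of_lt hx.le hxn, Int.emod_eq_of_lt hy.le hyn] at this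
  · rintro rfl; rfl

theorem gp_cast_eq_neg {n : ℕ} (x y : ℤ) (hx : 0 < x) (hxn : x < n) (hy : 0 < y) (hyn : y < n) :
    (x : ZMod n) = -(y : ZMod n) ↔ x + y = n := by
  have : -(y : ZMod n) = ((n - y : ℤ) : ZMod n) := by push_cast; simp
  rw [this, gp_cast_eq x (n - y) hx hxn (by omega) (by omega)]
  omega

theorem gp_perm (p q o r t w : ℤ)
    (h1 : 1 + (if p = q then (1 : ℤ) else 0) + (if p = o then 1 else 0) ≤
      (if p = r then 1 else 0) + (if p = t then 1 else 0) + (if p = w then 1 else 0))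
    (h2 : (if q = p then (1 : ℤ) else 0) + 1 + (if q = o then 1 else 0) ≤
      (if q = r then 1 else 0) + (if q = t then 1 else 0) + (if q = w then 1 else 0))
    (h3 : (if o = p then (1 : ℤ) else 0) + (if o = q then 1 else 0) + 1 ≤
      (if o = r then 1 else 0) + (if o = t then 1 else 0) + (if o = w then 1 else 0)) :
    (r = p ∧ t = q ∧ w = o) ∨ (r = p ∧ t = o ∧ w = q) ∨ (r = q ∧ t = p ∧ w = o) ∨
    (r = q ∧ t = o ∧ w = p) ∨ (r = o ∧ t = p ∧ w = q) ∨ (r = o ∧ t = q ∧ w = p) := by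
  grind (splits := 40)

theorem gp_lift {n : ℕ} (hn : 0 < n) (h3 : Nat.Coprime n 3) (l : (ZMod n)ˣ) :
    ∃ ℓ : ℤ, Int.gcd ℓ (3 * n) = 1 ∧ (ℓ : ZMod n) = l := by
  have : NeZero n := ⟨hn.ne'⟩
  obtain ⟨k, hk1, hk2⟩ := Nat.chineseRemainder h3 (l : ZMod n).val 1
  refine ⟨(k : ℤ), ?_, ?_⟩
  · have c1 : Nat.Coprime k n := by
      have := ZMod.val_coe_unit_coprime l
      unfold Nat.Coprime at this ⊢
      rw [hk1.gcd_eq]; exact this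
    have c2 : Nat.Coprime k 3 := by
      unfold Nat.Coprime
      rw [hk2.gcd_eq]; norm_num
    have : Nat.Coprime k (3 * n) := c2.mul_right c1
    exact_mod_cast this
  · have h := (ZMod.natCast_eq_natCast_iff _ _ _).mpr hk1
    rw [ZMod.natCast_zmod_val] at h
    rw [← h]; simp

set_option maxHeartbeats 2000000 in
theorem gp_forward {n : ℕ} (hn : 5 ≤ n) (hco : Nat.gcd n 6 = 1) (p q o r t w : ℤ)
    (hp : 0 < p) (hq : 0 < q) (ho : 0 < o) (hr : 0 < r) (ht : 0 < t) (hw : 0 < w)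
    (hpq : p + q + o = n) (hrt : r + t + w = n)
    (H : ∀ ℓ : ℤ, Int.gcd ℓ (3 * n) = 1 →
        ((ℓ * p) % (n : ℤ) + (ℓ * q) % (n : ℤ) < (n : ℤ) ↔
          (ℓ * r) % (n : ℤ) + (ℓ * t) % (n : ℤ) < (n : ℤ))) :
    (r = p ∧ t = q ∧ w = o) ∨ (r = p ∧ t = o ∧ w = q) ∨ (r = q ∧ t = p ∧ w = o) ∨
    (r = q ∧ t = o ∧ w = p) ∨ (r = o ∧ t = p ∧ w = q) ∨ (r = o ∧ t = q ∧ w = p) := by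
  have hn0 : 0 < n := by omega
  have : NeZero n := ⟨hn0.ne'⟩
  have hc6 : Nat.Coprime n (2 * 3) := hco
  have hc2 : Nat.Coprime n 2 := Nat.Coprime.coprime_mul_right_right hc6
  have hc3 : Nat.Coprime n 3 := Nat.Coprime.coprime_mul_left_right hc6
  have hodd : n % 2 = 1 := by
    have : ¬ 2 ∣ n := (Nat.Prime.coprime_iff_not_dvd Nat.prime_two).mp hc2.symm
    omega
  have u2 : IsUnit (2 : ZMod n) := by
    have := (ZMod.unitOfCoprime 2 hc2.symm).isUnit
    rw [ZMod.coe_unitOfCoprime] at this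
    exact_mod_cast this
  have u3 : IsUnit (3 : ZMod n) := by
    have := (ZMod.unitOfCoprime 3 hc3.symm).isUnit
    rw [ZMod.coe_unitOfCoprime] at this
    exact_mod_cast this
  have hprime : ∀ q, q.Prime → q ∣ n → 5 ≤ q := by
    intro q hq hqn
    by_contra hlt
    have h2 := hq.two_le
    have : q = 2 ∨ q = 3 ∨ q = 4 := by omega
    rcases this with rfl | rfl | rfl
    · omega
    · exact (Nat.Prime.coprime_iff_not_dvd Nat.prime_three).mp hc3.symm hqn
    · norm_num at hq
  have cne : ∀ x : ℤ, 0 < x → x < n → (x : ZMod n) ≠ 0 := by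
    intro x hx hxn h
    rw [ZMod.intCast_zmod_eq_zero_iff_dvd] at h
    have := Int.le_of_dvd hx h
    omega
  have hsumL : (p : ZMod n) + q + o = 0 := by
    have : ((p + q + o : ℤ) : ZMod n) = 0 := by rw [hpq]; simp
    exact_mod_cast this
  have hsumK : (r : ZMod n) + t + w = 0 := by
    have : ((r + t + w : ℤ) : ZMod n) = 0 := by rw [hrt]; simp
    exact_mod_cast this
  let a : Fin 2 → Fin 3 → ZMod n := ![![(p : ZMod n), q, o], ![-(r : ZMod n), -t, -w]]
  have hmain : ∀ x, gpC a x = 0 := by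
    refine gp_main u2 u3 hprime a ?_ ?_ ?_
    · intro s
      fin_cases s
      · simp [a, Fin.sum_univ_three, hsumL]
      · simp only [a, Fin.sum_univ_three]
        simp
        linear_combination -hsumK
    · intro s i
      fin_cases s <;> fin_cases i <;> simp [a] <;> apply cne <;> omega
    · intro l
      obtain ⟨ℓ, hℓ, hl⟩ := gp_lift hn0 hc3 l
      have v1 : ∀ x : ℤ, (((l : ZMod n) * (x : ZMod n)).val : ℤ) = (ℓ * x) % n := by
        intro x
        rw [← hl, ← Int.cast_mul, ZMod.val_intCast]
      have v2 : ∀ x : ℤ, 0 < x → x < n →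
          (((l : ZMod n) * -(x : ZMod n)).val : ℤ) = n - (ℓ * x) % n := by
        intro x hx hxn
        have hne : (l : ZMod n) * (x : ZMod n) ≠ 0 := by
          rw [Ne, Units.mul_right_eq_zero]; exact cne x hx hxn
        rw [mul_neg, ZMod.neg_val, if_neg hne, ← v1, Nat.cast_sub (ZMod.val_lt _).le]
      have g1 := gp_int hn0 ℓ hℓ p q o ho (by omega) hpq
      have g2 := gp_int hn0 ℓ hℓ r t w hw (by omega) hrt
      have hH := H ℓ hℓ
      have hL : ∑ s, ∑ i, (((l : ZMod n) * a s i).val : ℤ) =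
          (ℓ * p) % n + (ℓ * q) % n + (ℓ * o) % n +
          ((n - (ℓ * r) % n) + (n - (ℓ * t) % n) + (n - (ℓ * w) % n)) := by
        rw [← v1, ← v1, ← v1, ← v2 r hr (by omega), ← v2 t ht (by omega), ← v2 w hw (by omega)]
        simp only [Fin.sum_univ_two, Fin.sum_univ_three]
        rfl
      rw [hL]
      by_cases hlt : (ℓ * p) % (n : ℤ) + (ℓ * q) % (n : ℤ) < (n : ℤ)
      · have e1 := g1.1 hlt
        have e2 := g2.1 (hH.mp hlt)
        linarith
      · have e1 := g1.2 hlt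
        have e2 := g2.2 (fun h => hlt (hH.mpr h))
        linarith
  have hexp : ∀ x : ℤ, 0 < x → x < n → (if x = p then (1 : ℤ) else 0) + (if x = q then 1 else 0)
      + (if x = o then 1 else 0) - (if x + p = n then 1 else 0) - (if x + q = n then 1 else 0)
      - (if x + o = n then 1 else 0)
      + (if x + r = n then 1 else 0) + (if x + t = n then 1 else 0) + (if x + w = n then 1 else 0)
      - (if x = r then 1 else 0) - (if x = t then 1 else 0) - (if x = w then 1 else 0) = 0 := by
    intro x hx hxn
    have h := hmain (x : ZMod n)
    have e : gpC a (x : ZMod n) = ((if (x : ZMod n) = (p : ZMod n) then 1 else 0) -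
        (if (x : ZMod n) = -(p : ZMod n) then 1 else 0) +
        ((if (x : ZMod n) = (q : ZMod n) then 1 else 0) -
        (if (x : ZMod n) = -(q : ZMod n) then 1 else 0)) +
        ((if (x : ZMod n) = (o : ZMod n) then 1 else 0) -
        (if (x : ZMod n) = -(o : ZMod n) then 1 else 0))) +
        ((if (x : ZMod n) = -(r : ZMod n) then 1 else 0) -
        (if (x : ZMod n) = - -(r : ZMod n) then 1 else 0) +
        ((if (x : ZMod n) = -(t : ZMod n) then 1 else 0) -
        (if (x : ZMod n) = - -(t : ZMod n) then 1 else 0)) +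
        ((if (x : ZMod n) = -(w : ZMod n) then 1 else 0) -
        (if (x : ZMod n) = - -(w : ZMod n) then 1 else 0))) := by
      unfold gpC
      simp only [Fin.sum_univ_two, Fin.sum_univ_three]
      rfl
    rw [e] at h
    simp only [neg_neg, gp_cast_eq x p hx hxn hp (by omega), gp_cast_eq x q hx hxn hq (by omega),
      gp_cast_eq x o hx hxn ho (by omega), gp_cast_eq x r hx hxn hr (by omega),
      gp_cast_eq x t hx hxn ht (by omega), gp_cast_eq x w hx hxn hw (by omega),
      gp_cast_eq_neg x p hx hxn hp (by omega), gp_cast_eq_neg x q hx hxn hq (by omega),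
      gp_cast_eq_neg x o hx hxn ho (by omega), gp_cast_eq_neg x r hx hxn hr (by omega),
      gp_cast_eq_neg x t hx hxn ht (by omega), gp_cast_eq_neg x w hx hxn hw (by omega)] at h
    linarith
  have hle : ∀ x : ℤ, (x = p ∨ x = q ∨ x = o) →
      (if x = p then (1 : ℤ) else 0) + (if x = q then 1 else 0) + (if x = o then 1 else 0) ≤
      (if x = r then 1 else 0) + (if x = t then 1 else 0) + (if x = w then 1 else 0) := by
    intro x hx
    have h := hexp x (by omega) (by omega)
    rw [if_neg (show ¬ x + p = n by omega), if_neg (show ¬ x + q = n by omega),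
      if_neg (show ¬ x + o = n by omega)] at h
    have n1 : (0 : ℤ) ≤ if x + r = n then 1 else 0 := by split_ifs <;> norm_num
    have n2 : (0 : ℤ) ≤ if x + t = n then 1 else 0 := by split_ifs <;> norm_num
    have n3 : (0 : ℤ) ≤ if x + w = n then 1 else 0 := by split_ifs <;> norm_num
    linarith
  have h1 := hle p (by simp)
  have h2 := hle q (by simp)
  have h3 := hle o (by simp)
  rw [if_pos rfl] at h1
  rw [if_pos (rfl : q = q)] at h2
  rw [if_pos (rfl : o = o)] at h3
  exact gp_perm p q o r t w h1 h2 h3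

end GPfinal

theorem statement10 (n : ℕ) (hn : 5 ≤ n) (hco : Nat.gcd n 6 = 1)
    (lam kap : ℤ × ℤ) (hlam : lam ∈ Phi3 n) (hkap : kap ∈ Phi3 n) :
    (∀ ℓ : ℤ, Int.gcd ℓ (3 * n) = 1 →
        ((ℓ * lam.1) % (n : ℤ) + (ℓ * lam.2) % (n : ℤ) < (n : ℤ) ↔
          (ℓ * kap.1) % (n : ℤ) + (ℓ * kap.2) % (n : ℤ) < (n : ℤ))) ↔
      kap ∈ orbCJ n lam := by
  obtain ⟨p, q⟩ := lam
  obtain ⟨r, t⟩ := kap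
  simp only [Phi3, Finset.mem_filter, Finset.mem_Icc, Prod.mk_le_mk] at hlam hkap
  simp only [orbCJ, orbJ, Jv, Cv, Finset.mem_union, Finset.mem_insert, Finset.mem_singleton,
    Prod.mk.injEq]
  constructor
  · intro H
    have := gp_forward hn hco p q (n - p - q) r t (n - r - t) (by omega) (by omega) (by omega)
      (by omega) (by omega) (by omega) (by ring) (by ring) H
    omega
  · intro h ℓ hℓ
    rw [gp_iff (by omega) ℓ hℓ p q (n - p - q) (by omega) (by omega) (by ring),
      gp_iff (by omega) ℓ hℓ r t (n - r - t) (by omega) (by omega) (by ring)]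
    have key : ∀ x y z : ℤ, r = x → t = y → (n : ℤ) - r - t = z →
        (ℓ * x % n + ℓ * y % n + ℓ * z % n = ℓ * p % n + ℓ * q % n + ℓ * (n - p - q) % n) →
        (ℓ * p % n + ℓ * q % n + ℓ * (n - p - q) % n = n ↔
          ℓ * r % n + ℓ * t % n + ℓ * (n - r - t) % n = n) := by
      intro x y z hx hy hz he
      rw [hz, hx, hy, he]
    rcases h with (⟨h1, h2⟩ | ⟨h1, h2⟩ | ⟨h1, h2⟩) | (⟨h1, h2⟩ | ⟨h1, h2⟩ | ⟨h1, h2⟩)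
    · exact key p q (n - p - q) (by omega) (by omega) (by omega) (by ring)
    · exact key (n - p - q) p q (by omega) (by omega) (by omega) (by ring)
    · exact key q (n - p - q) p (by omega) (by omega) (by omega) (by ring)
    · exact key q p (n - p - q) (by omega) (by omega) (by omega) (by ring)
    · exact key (n - p - q) q p (by omega) (by omega) (by omega) (by ring)
    · exact key p (n - p - q) q (by omega) (by omega) (by omega) (by ring)
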